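/- arXiv:math/0001127 — 2 statements merged into one kernel-verified Lean document; each statement's English description precedes it below -/
import Mathlib

section
/- Let 𝔤 be a Lie algebra over k, S = S𝔤 its symmetric algebra, a ∈ S, and p ≥ 1. Then the k-linear endomorphism F : S → S given by F(x) = B_p(x, a) is a differential operator of order ≤ p. -/
noncomputable section

/-- The degree-`n` homogeneous component `S^n` of the symmetric algebra:
the span of `n`-fold products of elements of `𝔤` (realized as the `n`-th power of the
submodule `ι(𝔤) ⊆ S`). -/
def Sdeg (k : Type) [Field k] (L : Type) [LieRing L] [LieAlgebra k L]
    (S : Type) [CommRing S] [Algebra k S] (ι : L →ₗ[k] S) (n : ℕ) : Submodule k S :=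
  (LinearMap.range ι) ^ n

/-- `(S, ι)` is a model of the symmetric algebra of the Lie algebra `L`:
`S` is commutative and generated as a `k`-algebra by the image of `ι`. -/
def IsSymmAlg (k : Type) [Field k] (L : Type) [LieRing L] [LieAlgebra k L]
    (S : Type) [CommRing S] [Algebra k S] (ι : L →ₗ[k] S) : Prop :=
  Algebra.adjoin k (Set.range ι) = ⊤

/-- `e : S → U𝔤` is the symmetrization map: it sends a monomial `g₁ ⋯ g_p` to
`(1/p!) ∑_{σ ∈ S_p} g_{σ(1)} ⋯ g_{σ(p)}`. -/
def IsSymmetrization (k : Type) [Field k] (L : Type) [LieRing L] [LieAlgebra k L]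
    (S : Type) [CommRing S] [Algebra k S] (ι : L →ₗ[k] S)
    (e : S →ₗ[k] UniversalEnvelopingAlgebra k L) : Prop :=
  ∀ l : List L,
    e (l.map ι).prod = ((l.length.factorial : k)⁻¹) •
      ∑ σ : Equiv.Perm (Fin l.length),
        (List.ofFn fun i => UniversalEnvelopingAlgebra.ι k (l.get (σ i))).prod

/-- `B : ℕ → S →ₗ S →ₗ S` is the family of homogeneous components `B_p` of the product
`B(x,y) = e⁻¹(e(x)e(y))`: each `B p` lowers total degree by `p` (it maps `S^n ⊗ S^m`
to `S^{n+m-p}` and vanishes for `p > n+m`), and on homogeneous elements `x ∈ S^n`,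
`y ∈ S^m` one has `e (∑_{p=0}^{n+m} B p x y) = e x * e y`, i.e.
`e⁻¹(e(x)e(y)) = ∑_p B_p(x,y)`. -/
def IsPBWComponents (k : Type) [Field k] (L : Type) [LieRing L] [LieAlgebra k L]
    (S : Type) [CommRing S] [Algebra k S] (ι : L →ₗ[k] S)
    (e : S →ₗ[k] UniversalEnvelopingAlgebra k L)
    (B : ℕ → S →ₗ[k] S →ₗ[k] S) : Prop :=
  (∀ p n m, ∀ x ∈ Sdeg k L S ι n, ∀ y ∈ Sdeg k L S ι m,
      B p x y ∈ Sdeg k L S ι (n + m - p)) ∧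
  (∀ p n m, n + m < p → ∀ x ∈ Sdeg k L S ι n, ∀ y ∈ Sdeg k L S ι m, B p x y = 0) ∧
  (∀ n m, ∀ x ∈ Sdeg k L S ι n, ∀ y ∈ Sdeg k L S ι m,
      e (∑ p ∈ Finset.range (n + m + 1), B p x y) = e x * e y)


/-- A `k`-linear endomorphism `F` of a commutative associative `k`-algebra `A` is a
differential operator of order `≤ p` if
`∑_{S ⊆ {1,…,p+1}} (-1)^{#S} a_{S^c} F(a_S b) = 0` for all `a_1,…,a_{p+1}, b ∈ A`,
where `a_S` denotes the product of the `a_i` for `i ∈ S`. -/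
def IsDiffOpOrderLE (k : Type) [Field k] (A : Type) [CommRing A] [Algebra k A]
    (p : ℕ) (F : A →ₗ[k] A) : Prop :=
  ∀ (a : Fin (p + 1) → A) (b : A),
    ∑ T : Finset (Fin (p + 1)),
      (-1 : A) ^ T.card * (∏ i ∈ Tᶜ, a i) * F ((∏ i ∈ T, a i) * b) = 0

section Polarization

theorem mem_of_forall_sum_pow_smul_mem {k V : Type*} [Field k] [CharZero k] [AddCommGroup V]
    [Module k V] (W : Submodule k V) (N : ℕ) (v : ℕ → V)
    (h : ∀ t : k, ∑ j ∈ Finset.range N, t ^ j • v j ∈ W) {j : ℕ} (hj : j < N) : v j ∈ W := by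
  by_contra hv
  obtain ⟨φ, hφ, hW⟩ := Submodule.exists_le_ker_of_notMem hv
  refine hφ ?_
  set P : Polynomial k := ∑ i ∈ Finset.range N, Polynomial.monomial i (φ (v i)) with hP
  have hP0 : P = 0 := by
    refine Polynomial.funext fun t => ?_
    have := hW (h t)
    rw [LinearMap.mem_ker, map_sum] at this
    rw [hP, Polynomial.eval_finsetSum, Polynomial.eval_zero, ← this]
    exact Finset.sum_congr rfl fun i _ => by simp [mul_comm]
  have hc : P.coeff j = φ (v j) := by
    simp [hP, Polynomial.finsetSum_coeff, Polynomial.coeff_monomial, hj]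
  rw [← hc, hP0, Polynomial.coeff_zero]

theorem range_pow_le_span_pow {k M R : Type*} [Field k] [CharZero k] [AddCommGroup M] [Module k M]
    [CommRing R] [Algebra k R] (f : M →ₗ[k] R) (n : ℕ) :
    (LinearMap.range f) ^ n ≤ Submodule.span k (Set.range fun g => f g ^ n) := by
  induction n with
  | zero => simp [Submodule.one_eq_span]
  | succ n ih =>
    rw [pow_succ, Submodule.mul_le]
    rintro u hu _ ⟨h, rfl⟩
    replace hu := ih hu
    induction hu using Submodule.span_induction with
    | zero => simp
    | add x y _ _ hx hy => rw [add_mul]; exact add_mem hx hy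
    | smul c x _ hx => rw [smul_mul_assoc]; exact Submodule.smul_mem _ _ hx
    | mem x hx =>
      obtain ⟨g, rfl⟩ := hx
      have key := mem_of_forall_sum_pow_smul_mem
        (Submodule.span k (Set.range fun g => f g ^ (n + 1))) (n + 2)
        (fun j => ((n + 1).choose j : k) • (f g ^ (n + 1 - j) * f h ^ j)) ?_
        (j := 1) (by omega)
      · have hn : ((n : k) + 1) ≠ 0 := by exact_mod_cast n.succ_ne_zero
        have := Submodule.smul_mem _ ((n : k) + 1)⁻¹ key
        simpa [smul_smul, inv_mul_cancel₀ hn] using this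
      · intro t
        refine Submodule.subset_span ⟨g + t • h, ?_⟩
        simp only [map_add, map_smul]
        rw [add_comm, add_pow]
        refine Finset.sum_congr rfl fun j _ => ?_
        rw [smul_pow, Algebra.smul_def, Algebra.smul_def, Algebra.smul_def, map_natCast]
        ring

end Polarization

section DiffOp

open scoped TensorProduct

variable {k A : Type} [Field k] [CommRing A] [Algebra k A]

/-- The linear map `A ⊗ A → A` sending `s ⊗ b` to `s * F b`. -/
def tensorEval (F : A →ₗ[k] A) : A ⊗[k] A →ₗ[k] A :=
  LinearMap.mul' k A ∘ₗ LinearMap.lTensor A F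

@[simp]
theorem tensorEval_tmul (F : A →ₗ[k] A) (s b : A) : tensorEval F (s ⊗ₜ[k] b) = s * F b := by
  simp [tensorEval]

/-- The difference `a ⊗ 1 - 1 ⊗ a`, as a linear map in `a`. -/
def tensorDiff (k A : Type) [Field k] [CommRing A] [Algebra k A] : A →ₗ[k] A ⊗[k] A :=
  (TensorProduct.mk k A A).flip 1 - TensorProduct.mk k A A 1

theorem tensorDiff_apply (a : A) : tensorDiff k A a = a ⊗ₜ[k] 1 - 1 ⊗ₜ[k] a := rfl

theorem tensorDiff_mul (a b : A) :
    tensorDiff k A (a * b) =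
      (1 ⊗ₜ[k] b) * tensorDiff k A a + (a ⊗ₜ[k] 1) * tensorDiff k A b := by
  simp only [tensorDiff_apply, mul_sub, Algebra.TensorProduct.tmul_mul_tmul, one_mul, mul_one,
    mul_comm b a]
  abel

/-- The ideal of `A ⊗ A` generated by the differences `a ⊗ 1 - 1 ⊗ a`. -/
def diagIdeal (k A : Type) [Field k] [CommRing A] [Algebra k A] : Ideal (A ⊗[k] A) :=
  Ideal.span (Set.range (tensorDiff k A))

/-- `F` is a differential operator of order `< n`, i.e. `tensorEval F` kills the `n`-th power of
the diagonal ideal. -/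
def IsDiffOpLT (n : ℕ) (F : A →ₗ[k] A) : Prop :=
  ∀ t ∈ diagIdeal k A ^ n, tensorEval F t = 0

theorem tensorDiff_mem (a : A) : tensorDiff k A a ∈ diagIdeal k A :=
  Ideal.subset_span ⟨a, rfl⟩

theorem IsDiffOpLT.mono {m n : ℕ} (h : m ≤ n) {F : A →ₗ[k] A} (hF : IsDiffOpLT m F) :
    IsDiffOpLT n F := fun t ht => hF t (Ideal.pow_le_pow_right h ht)

theorem tensorEval_add (F G : A →ₗ[k] A) (t : A ⊗[k] A) :
    tensorEval (F + G) t = tensorEval F t + tensorEval G t := by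
  simp [tensorEval, LinearMap.lTensor_add]

theorem tensorEval_smul (c : k) (F : A →ₗ[k] A) (t : A ⊗[k] A) :
    tensorEval (c • F) t = c • tensorEval F t := by
  simp [tensorEval, LinearMap.lTensor_smul]

theorem IsDiffOpLT.zero (n : ℕ) : IsDiffOpLT n (0 : A →ₗ[k] A) := fun t _ => by
  simp [tensorEval]

theorem IsDiffOpLT.add {n : ℕ} {F G : A →ₗ[k] A} (hF : IsDiffOpLT n F) (hG : IsDiffOpLT n G) :
    IsDiffOpLT n (F + G) := fun t ht => by
  rw [tensorEval_add, hF t ht, hG t ht, add_zero]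

theorem IsDiffOpLT.smul {n : ℕ} (c : k) {F : A →ₗ[k] A} (hF : IsDiffOpLT n F) :
    IsDiffOpLT n (c • F) := fun t ht => by
  rw [tensorEval_smul, hF t ht, smul_zero]

theorem IsDiffOpLT.sub {n : ℕ} {F G : A →ₗ[k] A} (hF : IsDiffOpLT n F) (hG : IsDiffOpLT n G) :
    IsDiffOpLT n (F - G) := by
  rw [sub_eq_add_neg, ← neg_one_smul k G]
  exact hF.add (hG.smul _)

theorem IsDiffOpLT.sum {n : ℕ} {ι : Type*} {s : Finset ι} {F : ι → A →ₗ[k] A}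
    (hF : ∀ i ∈ s, IsDiffOpLT n (F i)) : IsDiffOpLT n (∑ i ∈ s, F i) :=
  Finset.sum_induction _ (IsDiffOpLT n) (fun _ _ => IsDiffOpLT.add) (IsDiffOpLT.zero n) hF

/-- The commutator of multiplication by `a` with `F`. -/
def mulCommutator (a : A) (F : A →ₗ[k] A) : A →ₗ[k] A :=
  LinearMap.mulLeft k a ∘ₗ F - F ∘ₗ LinearMap.mulLeft k a

theorem tensorEval_mul_tensorDiff (F : A →ₗ[k] A) (a : A) (t : A ⊗[k] A) :
    tensorEval F (t * tensorDiff k A a) = tensorEval (mulCommutator a F) t := by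
  induction t with
  | zero => simp
  | add x y hx hy => rw [add_mul, map_add, map_add, hx, hy]
  | tmul s b =>
    simp only [tensorDiff_apply, mul_sub, Algebra.TensorProduct.tmul_mul_tmul, map_sub,
      tensorEval_tmul, mulCommutator, LinearMap.sub_apply, LinearMap.comp_apply,
      LinearMap.mulLeft_apply, mul_one, mul_comm b a]
    ring

theorem isDiffOpLT_succ_iff {n : ℕ} {F : A →ₗ[k] A} :
    IsDiffOpLT (n + 1) F ↔ ∀ a, IsDiffOpLT n (mulCommutator a F) := by
  constructor
  · intro h a t ht
    rw [← tensorEval_mul_tensorDiff]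
    refine h _ ?_
    rw [pow_succ]
    exact Ideal.mul_mem_mul ht (tensorDiff_mem a)
  · intro h t ht
    rw [pow_succ] at ht
    induction ht using Submodule.mul_induction_on' with
    | add x _ y _ hx hy => rw [map_add, hx, hy, add_zero]
    | mem_mul_mem x hx y hy =>
      induction hy using Submodule.span_induction generalizing x with
      | zero => simp
      | add u v _ _ hu hv => rw [mul_add, map_add, hu x hx, hv x hx, add_zero]
      | smul c u _ hu =>
        rw [smul_eq_mul, ← mul_assoc]
        exact hu _ (Ideal.mul_mem_right _ _ hx)
      | mem u hu =>
        obtain ⟨a, rfl⟩ := hu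
        rw [tensorEval_mul_tensorDiff]
        exact h a x hx

theorem isDiffOpLT_zero_iff {F : A →ₗ[k] A} : IsDiffOpLT 0 F ↔ F = 0 := by
  constructor
  · intro h
    ext b
    simpa using h (1 ⊗ₜ[k] b) (by simp)
  · rintro rfl
    exact IsDiffOpLT.zero 0

theorem mulCommutator_comp (a : A) (F G : A →ₗ[k] A) :
    mulCommutator a (F ∘ₗ G) = mulCommutator a F ∘ₗ G + F ∘ₗ mulCommutator a G := by
  ext b
  simp [mulCommutator]

theorem IsDiffOpLT.comp {i j : ℕ} {F G : A →ₗ[k] A} (hF : IsDiffOpLT (i + 1) F)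
    (hG : IsDiffOpLT (j + 1) G) : IsDiffOpLT (i + j + 1) (F ∘ₗ G) := by
  induction hn : i + j generalizing i j F G with
  | zero =>
    obtain ⟨rfl, rfl⟩ : i = 0 ∧ j = 0 := by omega
    rw [isDiffOpLT_succ_iff] at *
    intro a
    have h1 := isDiffOpLT_zero_iff.1 (hF a)
    have h2 := isDiffOpLT_zero_iff.1 (hG a)
    rw [mulCommutator_comp, h1, h2, LinearMap.zero_comp, LinearMap.comp_zero, add_zero]
    exact IsDiffOpLT.zero _
  | succ n ih =>
    rw [isDiffOpLT_succ_iff]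
    intro a
    rw [mulCommutator_comp]
    refine IsDiffOpLT.add ?_ ?_
    · have h := isDiffOpLT_succ_iff.1 hF a
      rcases i with _ | i
      · rw [isDiffOpLT_zero_iff.1 h, LinearMap.zero_comp]
        exact IsDiffOpLT.zero _
      · exact ih h hG (by omega)
    · have h := isDiffOpLT_succ_iff.1 hG a
      rcases j with _ | j
      · rw [isDiffOpLT_zero_iff.1 h, LinearMap.comp_zero]
        exact IsDiffOpLT.zero _
      · exact ih hF h (by omega)

theorem isDiffOpLT_one_smul_id (c : k) : IsDiffOpLT 1 (c • (LinearMap.id : A →ₗ[k] A)) := by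
  rw [isDiffOpLT_succ_iff]
  intro a
  rw [isDiffOpLT_zero_iff]
  ext b
  simp [mulCommutator]

theorem tensorEval_prod_tensorDiff {n : ℕ} (F : A →ₗ[k] A) (a : Fin n → A) (b : A) :
    tensorEval F ((∏ i, tensorDiff k A (a i)) * 1 ⊗ₜ[k] b) =
      ∑ T : Finset (Fin n), (-1 : A) ^ T.card * (∏ i ∈ Tᶜ, a i) * F ((∏ i ∈ T, a i) * b) := by
  have hl (T : Finset (Fin n)) :
      ∏ i ∈ T, (a i ⊗ₜ[k] (1 : A)) = (∏ i ∈ T, a i) ⊗ₜ[k] (1 : A) :=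
    (map_prod (Algebra.TensorProduct.includeLeft : A →ₐ[k] A ⊗[k] A) a T).symm
  have hr (T : Finset (Fin n)) :
      ∏ i ∈ T, ((1 : A) ⊗ₜ[k] a i) = (1 : A) ⊗ₜ[k] (∏ i ∈ T, a i) :=
    (map_prod (Algebra.TensorProduct.includeRight : A →ₐ[k] A ⊗[k] A) a T).symm
  have h : ∏ i, tensorDiff k A (a i) =
      ∑ T : Finset (Fin n), ((-1 : A) ^ T.card * ∏ i ∈ Tᶜ, a i) ⊗ₜ[k] (∏ i ∈ T, a i) := by
    simp only [tensorDiff_apply, sub_eq_neg_add]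
    rw [Finset.prod_add, Finset.powerset_univ]
    refine Finset.sum_congr rfl fun T _ => ?_
    rw [Finset.prod_neg, hr, ← Finset.compl_eq_univ_sdiff, hl, mul_assoc,
      Algebra.TensorProduct.tmul_mul_tmul, one_mul, mul_one]
    rcases Nat.even_or_odd T.card with h' | h' <;>
      simp [h'.neg_one_pow, TensorProduct.neg_tmul]
  rw [h, Finset.sum_mul, map_sum]
  simp

theorem IsDiffOpLT.isDiffOpOrderLE {p : ℕ} {F : A →ₗ[k] A} (hF : IsDiffOpLT (p + 1) F) :
    IsDiffOpOrderLE k A p F := fun a b => by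
  rw [← tensorEval_prod_tensorDiff]
  refine hF _ (Ideal.mul_mem_right _ _ ?_)
  have := Ideal.prod_mem_prod (s := Finset.univ) (I := fun _ : Fin (p + 1) => diagIdeal k A)
    (x := fun i => tensorDiff k A (a i)) fun i _ => tensorDiff_mem (a i)
  simpa using this

variable {M : Type} [AddCommGroup M] [Module k M]

theorem diagIdeal_eq_span_of_adjoin {ι : M →ₗ[k] A}
    (hι : Algebra.adjoin k (Set.range ι) = ⊤) :
    diagIdeal k A = Ideal.span (Set.range (tensorDiff k A ∘ₗ ι)) := by
  apply le_antisymm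
  · rw [diagIdeal, Ideal.span_le]
    rintro _ ⟨a, rfl⟩
    have ha : a ∈ Algebra.adjoin k (Set.range ι) := by rw [hι]; trivial
    induction ha using Algebra.adjoin_induction with
    | mem x hx =>
      obtain ⟨g, rfl⟩ := hx
      exact Ideal.subset_span ⟨g, rfl⟩
    | algebraMap r =>
      have : tensorDiff k A (algebraMap k A r) = 0 := by
        rw [tensorDiff_apply, Algebra.algebraMap_eq_smul_one, TensorProduct.smul_tmul, sub_self]
      rw [this]
      exact Submodule.zero_mem _
    | add x y _ _ hx hy => rw [map_add]; exact add_mem hx hy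
    | mul x y _ _ hx hy =>
      rw [tensorDiff_mul]
      exact add_mem (Ideal.mul_mem_left _ _ hx) (Ideal.mul_mem_left _ _ hy)
  · rw [Ideal.span_le]
    rintro _ ⟨g, rfl⟩
    exact tensorDiff_mem _

/-- An operator on an algebra generated by `ι(M)` has order `< n` as soon as `tensorEval` kills
all powers `(ι g ⊗ 1 - 1 ⊗ ι g) ^ m` with `n ≤ m`. -/
theorem isDiffOpLT_of_forall_pow [CharZero k] {ι : M →ₗ[k] A}
    (hι : Algebra.adjoin k (Set.range ι) = ⊤) {n : ℕ} {F : A →ₗ[k] A}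
    (hF : ∀ m, n ≤ m → ∀ g, tensorEval F (tensorDiff k A (ι g) ^ m) = 0) :
    IsDiffOpLT n F := by
  set d : M →ₗ[k] A ⊗[k] A := tensorDiff k A ∘ₗ ι with hd
  let X : Submodule k (A ⊗[k] A) :=
    { carrier := {t | ∀ m, n ≤ m → ∀ v ∈ LinearMap.range d ^ m, tensorEval F (t * v) = 0}
      zero_mem' := fun m _ v _ => by simp
      add_mem' := fun hx hy m hm v hv => by
        rw [add_mul, map_add, hx m hm v hv, hy m hm v hv, add_zero]
      smul_mem' := fun c x hx m hm v hv => by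
        rw [smul_mul_assoc, map_smul, hx m hm v hv, smul_zero] }
  have hone : (1 : A ⊗[k] A) ∈ X := by
    intro m hm v hv
    rw [one_mul]
    replace hv := range_pow_le_span_pow d m hv
    induction hv using Submodule.span_induction with
    | zero => simp
    | add x y _ _ hx hy => rw [map_add, hx, hy, add_zero]
    | smul c x _ hx => rw [map_smul, hx, smul_zero]
    | mem x hx =>
      obtain ⟨g, rfl⟩ := hx
      exact hF m hm g
  have hleft (s : A) (t) (ht : t ∈ X) : t * s ⊗ₜ[k] 1 ∈ X := by
    intro m hm v hv
    have h (u : A ⊗[k] A) : tensorEval F ((s ⊗ₜ[k] 1) * u) = s * tensorEval F u := by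
      induction u with
      | zero => simp
      | add x y hx hy => rw [mul_add, map_add, map_add, hx, hy, mul_add]
      | tmul x y => simp [mul_assoc]
    rw [mul_comm t, mul_assoc, h, ht m hm v hv, mul_zero]
  have hright (b : A) : ∀ t ∈ X, t * 1 ⊗ₜ[k] b ∈ X := by
    have hb : b ∈ Algebra.adjoin k (Set.range ι) := by rw [hι]; trivial
    induction hb using Algebra.adjoin_induction with
    | mem x hx =>
      obtain ⟨g, rfl⟩ := hx
      intro t ht
      have h : (1 : A) ⊗ₜ[k] ι g = ι g ⊗ₜ[k] 1 - d g := by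
        simp [hd, tensorDiff_apply]
      rw [h, mul_sub]
      refine sub_mem (hleft _ _ ht) ?_
      intro m hm v hv
      rw [mul_assoc]
      refine ht (m + 1) (by omega) _ ?_
      rw [pow_succ']
      exact Submodule.mul_mem_mul ⟨g, rfl⟩ hv
    | algebraMap r =>
      intro t ht
      rw [Algebra.algebraMap_eq_smul_one, ← TensorProduct.smul_tmul]
      exact hleft _ _ ht
    | add x y _ _ hx hy =>
      intro t ht
      rw [TensorProduct.tmul_add, mul_add]
      exact add_mem (hx t ht) (hy t ht)
    | mul x y _ _ hx hy =>
      intro t ht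
      have h : (1 : A) ⊗ₜ[k] (x * y) = 1 ⊗ₜ[k] x * 1 ⊗ₜ[k] y := by simp
      rw [h, ← mul_assoc]
      exact hy _ (hx t ht)
  have htop (t) : t ∈ X := by
    induction t with
    | zero => exact zero_mem _
    | add x y hx hy => exact add_mem hx hy
    | tmul s b =>
      have h : s ⊗ₜ[k] b = 1 * s ⊗ₜ[k] 1 * 1 ⊗ₜ[k] b := by simp
      rw [h]
      exact hright _ _ (hleft _ _ hone)
  intro t ht
  rw [diagIdeal_eq_span_of_adjoin hι, Ideal.span, Submodule.span_pow] at ht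
  suffices h : ∀ s, tensorEval F (s * t) = 0 by simpa using h 1
  induction ht using Submodule.span_induction with
  | zero => simp
  | add x y _ _ hx hy => intro s; rw [mul_add, map_add, hx, hy, add_zero]
  | smul c x _ hx => intro s; rw [smul_eq_mul, ← mul_assoc, hx]
  | mem x hx =>
    exact fun s => htop s n le_rfl x (Submodule.pow_subset_pow (M := LinearMap.range d) hx)

end DiffOp

section Bernoulli

open Finset

theorem Commute.sum_pow_mul_add_pow {R : Type*} [Ring R] {l b : R} (h : Commute l b) (m : ℕ) :
    ∑ i ∈ range (m + 1), l ^ i * (l + b) ^ (m - i) =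
      ∑ j ∈ range (m + 1), (m + 1).choose (j + 1) • (l ^ (m - j) * b ^ j) := by
  induction m with
  | zero => simp
  | succ m ih =>
    have h1 : ∑ i ∈ range (m + 2), l ^ i * (l + b) ^ (m + 1 - i) =
        l * ∑ i ∈ range (m + 1), l ^ i * (l + b) ^ (m - i) + (b + l) ^ (m + 1) := by
      rw [sum_range_succ', mul_sum, add_comm b]
      simp [pow_succ', mul_assoc]
    rw [h1, ih, h.symm.add_pow, mul_sum,
      sum_congr rfl fun j _ => show (m + 1 + 1).choose (j + 1) • (l ^ (m + 1 - j) * b ^ j) =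
        (m + 1).choose (j + 1) • (l ^ (m + 1 - j) * b ^ j) +
        (m + 1).choose j • (l ^ (m + 1 - j) * b ^ j) by
          rw [← add_smul, Nat.choose_succ_succ, add_comm], sum_add_distrib]
    congr 1
    · rw [sum_range_succ _ (m + 1), Nat.choose_eq_zero_of_lt (by omega : m + 1 < m + 1 + 1),
        zero_smul, add_zero]
      refine sum_congr rfl fun j hj => ?_
      have : m + 1 - j = (m - j) + 1 := by have := mem_range.1 hj; omega
      rw [this, pow_succ', mul_smul_comm, mul_assoc]
    · refine sum_congr rfl fun j _ => ?_
      rw [nsmul_eq_mul, (Nat.cast_commute _ _).eq, ((h.symm.pow_pow j _)).eq]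

theorem Commute.sum_bernoulli_smul {k R : Type*} [Field k] [CharZero k] [Ring R] [Algebra k R]
    {l b : R} (h : Commute l b) (n : ℕ) :
    ∑ p ∈ range (n + 1), ((bernoulli p : k) * n.choose p) •
      ((((n - p : ℕ) : k) + 1)⁻¹ • ((∑ i ∈ range (n - p + 1), l ^ i * (l + b) ^ (n - p - i)) *
        b ^ p)) = l ^ n := by
  have hc (m j : ℕ) : ((m : k) + 1)⁻¹ * (m + 1).choose (j + 1) = m.choose j / (j + 1) := by
    have hm : ((m : k) + 1) ≠ 0 := by exact_mod_cast m.succ_ne_zero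
    have hj : ((j : k) + 1) ≠ 0 := by exact_mod_cast j.succ_ne_zero
    have := Nat.add_one_mul_choose_eq m j
    have : ((m : k) + 1) * m.choose j = (m + 1).choose (j + 1) * (j + 1) := by exact_mod_cast this
    field_simp
    linear_combination -this
  set f : ℕ → ℕ → R := fun p j => ((bernoulli p : k) * n.choose p * ((n - p).choose j / (j + 1))) •
    (l ^ (n - p - j) * b ^ (j + p)) with hf
  have h1 : ∀ p ∈ range (n + 1), ((bernoulli p : k) * n.choose p) •
      ((((n - p : ℕ) : k) + 1)⁻¹ • ((∑ i ∈ range (n - p + 1), l ^ i * (l + b) ^ (n - p - i)) *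
        b ^ p)) = ∑ j ∈ range (n + 1 - p), f p j := by
    intro p hp
    have hp' : n + 1 - p = n - p + 1 := by have := mem_range.1 hp; omega
    rw [h.sum_pow_mul_add_pow, sum_mul, smul_sum, smul_sum, hp']
    refine sum_congr rfl fun j _ => ?_
    simp only [hf]
    rw [← hc, ← Nat.cast_smul_eq_nsmul k, smul_mul_assoc, smul_smul, smul_smul]
    simp only [mul_assoc, pow_add]
  rw [sum_congr rfl h1, ← sum_range_diag_flip]
  have h2 : ∀ s ∈ range (n + 1), ∑ p ∈ range (s + 1), f p (s - p) =
      if s = 0 then l ^ n else 0 := by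
    intro s hs
    have hs := mem_range.1 hs
    have h3 : ∀ p ∈ range (s + 1), f p (s - p) =
        (((s.choose (s - p) : k) / ((s - p : ℕ) + 1) * (bernoulli p : k)) * n.choose s) •
          (l ^ (n - s) * b ^ s) := by
      intro p hp
      have hp := mem_range.1 hp
      have e1 : n - p - (s - p) = n - s := by omega
      have e2 : s - p + p = s := by omega
      have e3 : ((n.choose s : k) * s.choose p) = n.choose p * (n - p).choose (s - p) := by
        exact_mod_cast Nat.choose_mul (by omega)
      rw [hf, Nat.choose_symm (by omega : p ≤ s)]
      simp only [e1, e2]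
      congr 1
      linear_combination (-(bernoulli p : k) / ((s - p : ℕ) + 1)) * e3
    have h4 := bernoulli_spec' s
    rw [Nat.sum_antidiagonal_eq_sum_range_succ_mk] at h4
    have h5 : ∑ p ∈ range (s + 1), (s.choose (s - p) : k) / ((s - p : ℕ) + 1) * (bernoulli p : k) =
        if s = 0 then 1 else 0 := by
      have := congrArg (Rat.cast : ℚ → k) h4
      rw [apply_ite (Rat.cast : ℚ → k)] at this
      push_cast at this
      rw [← this]
      refine sum_congr rfl fun p hp => ?_
      have hp := mem_range.1 hp
      rw [Nat.add_sub_cancel' (by omega : p ≤ s)]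
    rw [sum_congr rfl h3, ← sum_smul, ← sum_mul, h5]
    split_ifs with h0 <;> simp [h0]
  rw [sum_congr rfl h2]
  simp

end Bernoulli

section Symmetrization

variable {k : Type} [Field k] {L : Type} [LieRing L] [LieAlgebra k L]
  {S : Type} [CommRing S] [Algebra k S] {ι : L →ₗ[k] S}
  {e : S →ₗ[k] UniversalEnvelopingAlgebra k L}

theorem IsSymmetrization.apply_prod (he : IsSymmetrization k L S ι e) {n : ℕ} (w : Fin n → L) :
    e (∏ i, ι (w i)) = ((n.factorial : k)⁻¹) •
      ∑ σ : Equiv.Perm (Fin n),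
        (List.ofFn fun i => UniversalEnvelopingAlgebra.ι k (w (σ i))).prod := by
  obtain ⟨l, hl, hw⟩ : ∃ l : List L, ∃ h : l.length = n, ∀ i, l.get (i.cast h.symm) = w i :=
    ⟨List.ofFn w, List.length_ofFn, fun i => by simp⟩
  subst hl
  obtain rfl : l.get = w := funext hw
  rw [← he l, ← List.prod_ofFn]
  congr 2
  conv_rhs => rw [← List.ofFn_get l, List.map_ofFn]
  rfl

theorem prod_ofFn_ite {R : Type*} [Monoid R] (X Z : R) {n : ℕ} (p : Fin (n + 1)) :
    (List.ofFn fun i => if i = p then Z else X).prod = X ^ (p : ℕ) * Z * X ^ (n - p) := by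
  induction n with
  | zero => obtain rfl : p = 0 := Fin.fin_one_eq_zero p; simp
  | succ n ih =>
    rw [List.ofFn_succ, List.prod_cons]
    cases p using Fin.cases with
    | zero => simp [Fin.succ_ne_zero, List.ofFn_const, pow_succ']
    | succ p =>
      simp only [Fin.succ_inj, ih p]
      rw [if_neg (Fin.succ_ne_zero p).symm]
      simp [pow_succ', mul_assoc]

theorem sum_perm_inv_apply_zero {V : Type*} [AddCommMonoid V] {n : ℕ} (f : Fin (n + 1) → V) :
    ∑ σ : Equiv.Perm (Fin (n + 1)), f (σ⁻¹ 0) = n.factorial • ∑ p, f p := by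
  rw [show ∑ σ : Equiv.Perm (Fin (n + 1)), f (σ⁻¹ 0) = ∑ σ : Equiv.Perm (Fin (n + 1)), f (σ 0)
    from Equiv.sum_comp (Equiv.inv (Equiv.Perm (Fin (n + 1)))) fun σ => f (σ 0),
    ← Equiv.sum_comp Equiv.Perm.decomposeFin.symm, Fintype.sum_prod_type, Finset.smul_sum]
  simp [Fintype.card_perm]

variable [CharZero k]

theorem IsSymmetrization.apply_pow (he : IsSymmetrization k L S ι e) (g : L) (n : ℕ) :
    e (ι g ^ n) = UniversalEnvelopingAlgebra.ι k g ^ n := by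
  have h := he.apply_prod (fun _ : Fin n => g)
  have hn : (n.factorial : k) ≠ 0 := by exact_mod_cast n.factorial_ne_zero
  simpa [List.ofFn_const, Fintype.card_perm, ← Nat.cast_smul_eq_nsmul k, smul_smul, hn] using h

theorem IsSymmetrization.apply_pow_mul (he : IsSymmetrization k L S ι e) (g z : L) (n : ℕ) :
    e (ι g ^ n * ι z) = ((n : k) + 1)⁻¹ • ∑ i ∈ Finset.range (n + 1),
      UniversalEnvelopingAlgebra.ι k g ^ i * UniversalEnvelopingAlgebra.ι k z *
        UniversalEnvelopingAlgebra.ι k g ^ (n - i) := by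
  set X := UniversalEnvelopingAlgebra.ι k g
  set Z := UniversalEnvelopingAlgebra.ι k z
  have h := he.apply_prod (fun i : Fin (n + 1) => if i = 0 then z else g)
  have h1 : ∏ i : Fin (n + 1), ι (if i = 0 then z else g) = ι g ^ n * ι z := by
    rw [Fin.prod_univ_succ]
    simp [Fin.succ_ne_zero, mul_comm]
  have h2 (σ : Equiv.Perm (Fin (n + 1))) :
      (List.ofFn fun i => UniversalEnvelopingAlgebra.ι k (if σ i = 0 then z else g)).prod =
        X ^ ((σ⁻¹ 0 : Fin (n + 1)) : ℕ) * Z * X ^ (n - (σ⁻¹ 0 : Fin (n + 1))) := by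
    rw [← prod_ofFn_ite]
    congr 2
    ext i
    simp only [Equiv.Perm.eq_inv_iff_eq, apply_ite (UniversalEnvelopingAlgebra.ι k)]
    rfl
  rw [h1] at h
  rw [h, Finset.sum_congr rfl fun σ _ => h2 σ,
    sum_perm_inv_apply_zero fun p : Fin (n + 1) => X ^ (p : ℕ) * Z * X ^ (n - p),
    Fin.sum_univ_eq_sum_range fun p => X ^ p * Z * X ^ (n - p), ← Nat.cast_smul_eq_nsmul k,
    smul_smul]
  congr 1
  have hn : (n.factorial : k) ≠ 0 := by exact_mod_cast n.factorial_ne_zero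
  have hn' : ((n : k) + 1) ≠ 0 := by exact_mod_cast n.succ_ne_zero
  rw [Nat.factorial_succ]
  push_cast
  field_simp

/-- Right multiplication by a generator in terms of symmetrized monomials. -/
theorem IsSymmetrization.pow_mul_ι (he : IsSymmetrization k L S ι e) (g z : L) (n : ℕ) :
    UniversalEnvelopingAlgebra.ι k g ^ n * UniversalEnvelopingAlgebra.ι k z =
      e (∑ p ∈ Finset.range (n + 1), ((bernoulli p : k) * n.choose p) •
        (ι g ^ (n - p) * ι (((-LieAlgebra.ad k L g) ^ p) z))) := by
  set X := UniversalEnvelopingAlgebra.ι k g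
  set l := LinearMap.mulLeft k X
  set r := LinearMap.mulRight k X
  have hlr : Commute l r := LinearMap.commute_mulLeft_right X X
  have hlb : Commute l (r - l) := hlr.sub_right (Commute.refl l)
  have hb (p : ℕ) : UniversalEnvelopingAlgebra.ι k (((-LieAlgebra.ad k L g) ^ p) z) =
      ((r - l) ^ p) (UniversalEnvelopingAlgebra.ι k z) := by
    induction p with
    | zero => simp
    | succ p ih =>
      rw [pow_succ', pow_succ', Module.End.mul_apply, Module.End.mul_apply, ← ih]
      simp only [LinearMap.neg_apply, LieAlgebra.ad_apply, map_neg, LieHom.map_lie,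
        LieRing.of_associative_ring_bracket, LinearMap.sub_apply, l, r, LinearMap.mulLeft_apply,
        LinearMap.mulRight_apply, X]
      abel
  have h := congrArg (fun T : Module.End k _ => T (UniversalEnvelopingAlgebra.ι k z))
    (hlb.sum_bernoulli_smul (k := k) n)
  have hl (i : ℕ) (u) : (l ^ i) u = X ^ i * u := by simp [l, LinearMap.pow_mulLeft]
  have hr (i : ℕ) (u) : (r ^ i) u = u * X ^ i := by simp [r, LinearMap.pow_mulRight]
  simp only [add_sub_cancel, LinearMap.sum_apply, LinearMap.smul_apply, Module.End.mul_apply,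
    ← hb, hl, hr] at h
  rw [← h, map_sum]
  refine Finset.sum_congr rfl fun p _ => ?_
  rw [map_smul, he.apply_pow_mul]
  simp only [X, mul_assoc]

end Symmetrization

section Grading

open scoped TensorProduct

attribute [local instance] LieRing.ofAssociativeRing

/-- The coproduct of the universal enveloping algebra, for which `ι g` is primitive. -/
def ueaComul (k L : Type) [Field k] [LieRing L] [LieAlgebra k L] :
    UniversalEnvelopingAlgebra k L →ₐ[k]
      UniversalEnvelopingAlgebra k L ⊗[k] UniversalEnvelopingAlgebra k L :=
  UniversalEnvelopingAlgebra.lift k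
    { toFun := fun g => UniversalEnvelopingAlgebra.ι k g ⊗ₜ[k] 1 +
        1 ⊗ₜ[k] UniversalEnvelopingAlgebra.ι k g
      map_add' := fun x y => by
        simp only [map_add, TensorProduct.add_tmul, TensorProduct.tmul_add]
        abel
      map_smul' := fun c x => by
        simp [TensorProduct.smul_tmul']
      map_lie' := fun {x y} => by
        simp only [LieHom.map_lie, LieRing.of_associative_ring_bracket, add_mul, mul_add,
          Algebra.TensorProduct.tmul_mul_tmul, one_mul, mul_one, TensorProduct.sub_tmul,
          TensorProduct.tmul_sub]
        abel }

/-- The second Adams operation: the coproduct followed by multiplication. -/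
def ueaAdams (k L : Type) [Field k] [LieRing L] [LieAlgebra k L] :
    Module.End k (UniversalEnvelopingAlgebra k L) :=
  LinearMap.mul' k _ ∘ₗ (ueaComul k L).toLinearMap

theorem ueaAdams_ι_pow {k L : Type} [Field k] [LieRing L] [LieAlgebra k L] (g : L) (n : ℕ) :
    ueaAdams k L (UniversalEnvelopingAlgebra.ι k g ^ n) =
      (2 : k) ^ n • UniversalEnvelopingAlgebra.ι k g ^ n := by
  set X := UniversalEnvelopingAlgebra.ι k g with hX
  have h : ueaComul k L X = X ⊗ₜ[k] 1 + 1 ⊗ₜ[k] X := by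
    rw [ueaComul, hX, UniversalEnvelopingAlgebra.lift_ι_apply]
    rfl
  have hc : Commute (X ⊗ₜ[k] (1 : UniversalEnvelopingAlgebra k L)) (1 ⊗ₜ[k] X) := by
    simp [Commute, SemiconjBy]
  rw [ueaAdams, LinearMap.comp_apply, AlgHom.toLinearMap_apply, map_pow, h, hc.add_pow, map_sum]
  have : ∀ i ∈ Finset.range (n + 1), LinearMap.mul' k (UniversalEnvelopingAlgebra k L)
      ((X ⊗ₜ[k] 1) ^ i * (1 ⊗ₜ[k] X) ^ (n - i) * ((n.choose i : ℕ) :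
        UniversalEnvelopingAlgebra k L ⊗[k] UniversalEnvelopingAlgebra k L)) =
      (n.choose i : k) • X ^ n := by
    intro i hi
    have hi := Finset.mem_range.1 hi
    rw [(Nat.cast_commute _ _).symm.eq, ← nsmul_eq_mul, map_nsmul, Nat.cast_smul_eq_nsmul]
    simp [Algebra.TensorProduct.tmul_pow, ← pow_add, Nat.add_sub_cancel' (by omega : i ≤ n)]
  rw [Finset.sum_congr rfl this, ← Finset.sum_smul]
  congr 1
  rw [← Nat.cast_sum, Nat.sum_range_choose, Nat.cast_pow, Nat.cast_ofNat]

variable {k : Type} [Field k] [CharZero k] {L : Type} [LieRing L] [LieAlgebra k L]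
  {S : Type} [CommRing S] [Algebra k S] {ι : L →ₗ[k] S}
  {e : S →ₗ[k] UniversalEnvelopingAlgebra k L}

theorem IsSymmetrization.mem_eigenspace (he : IsSymmetrization k L S ι e) {n : ℕ} {x : S}
    (hx : x ∈ Sdeg k L S ι n) : e x ∈ (ueaAdams k L).eigenspace ((2 : k) ^ n) := by
  replace hx := range_pow_le_span_pow ι n hx
  induction hx using Submodule.span_induction with
  | zero => simp
  | add x y _ _ hx hy => rw [map_add]; exact add_mem hx hy
  | smul c x _ hx => rw [map_smul]; exact Submodule.smul_mem _ _ hx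
  | mem x hx =>
    obtain ⟨g, rfl⟩ := hx
    rw [Module.End.mem_eigenspace_iff, he.apply_pow, ueaAdams_ι_pow]

/-- Homogeneous components are determined by their sum. -/
theorem IsSymmetrization.eq_of_sum_eq (he : IsSymmetrization k L S ι e)
    (hinj : Function.Injective e) {D : ℕ} {z w : ℕ → S}
    (hz : ∀ p ≤ D, z p ∈ Sdeg k L S ι (D - p)) (hw : ∀ p ≤ D, w p ∈ Sdeg k L S ι (D - p))
    (h : ∑ p ∈ Finset.range (D + 1), z p = ∑ p ∈ Finset.range (D + 1), w p)
    {p : ℕ} (hp : p ≤ D) : z p = w p := by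
  have hpow : Function.Injective fun n : ℕ => (2 : k) ^ n := fun m n hmn =>
    Nat.pow_right_injective le_rfl (Nat.cast_injective (R := k) (by simpa using hmn))
  have hind := (Module.End.eigenspaces_iSupIndep (ueaAdams k L)).comp hpow
  rw [iSupIndep_iff_finsetSum_eq_zero_imp_eq_zero] at hind
  rw [← Finset.sum_range_reflect z, ← Finset.sum_range_reflect w] at h
  have := hind (Finset.range (D + 1)) (fun n => e (z (D - n) - w (D - n))) ?_ ?_ (D - p)
    (Finset.mem_range.2 (by omega))
  · rw [Nat.sub_sub_self hp, map_eq_zero_iff e hinj, sub_eq_zero] at this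
    exact this
  · intro n hn
    have hn := Finset.mem_range.1 hn
    have h1 := hz (D - n) (by omega)
    have h2 := hw (D - n) (by omega)
    rw [Nat.sub_sub_self (by omega)] at h1 h2
    exact he.mem_eigenspace (sub_mem h1 h2)
  · rw [← map_sum, Finset.sum_sub_distrib]
    simp only [Nat.add_sub_cancel] at h
    rw [h, sub_self, map_zero]

end Grading

section Components

open scoped TensorProduct

variable {k : Type} [Field k] {L : Type} [LieRing L] [LieAlgebra k L]
  {S : Type} [CommRing S] [Algebra k S] {ι : L →ₗ[k] S}
  {e : S →ₗ[k] UniversalEnvelopingAlgebra k L} {B : ℕ → S →ₗ[k] S →ₗ[k] S}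

theorem ι_mem_Sdeg (g : L) : ι g ∈ Sdeg k L S ι 1 := by
  rw [Sdeg, pow_one]
  exact ⟨g, rfl⟩

theorem pow_ι_mem_Sdeg (g : L) (n : ℕ) : ι g ^ n ∈ Sdeg k L S ι n :=
  Submodule.pow_mem_pow _ (LinearMap.mem_range_self ι g) n

theorem mul_ι_mem_Sdeg {n : ℕ} {x : S} (hx : x ∈ Sdeg k L S ι n) (g : L) :
    x * ι g ∈ Sdeg k L S ι (n + 1) := by
  rw [Sdeg, pow_succ]
  exact Submodule.mul_mem_mul hx ⟨g, rfl⟩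

/-- The homogeneous components span the whole algebra. -/
theorem IsSymmAlg.induction (hS : IsSymmAlg k L S ι) {C : S → Prop}
    (hadd : ∀ x y, C x → C y → C (x + y)) (hC : ∀ n, ∀ x ∈ Sdeg k L S ι n, C x) (x : S) : C x := by
  have hmem : x ∈ ⨆ n, Sdeg k L S ι n := by
    have hx : x ∈ Algebra.adjoin k (Set.range ι) := by rw [hS]; trivial
    rw [← Subalgebra.mem_toSubmodule, Algebra.adjoin_eq_span] at hx
    refine Submodule.span_le.2 ?_ hx
    intro y hy
    suffices h : ∃ n, y ∈ Sdeg k L S ι n by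
      obtain ⟨n, hn⟩ := h
      exact Submodule.mem_iSup_of_mem n hn
    induction hy using Submonoid.closure_induction with
    | mem y hy => obtain ⟨g, rfl⟩ := hy; exact ⟨1, ι_mem_Sdeg g⟩
    | one => exact ⟨0, by rw [Sdeg, pow_zero]; exact Submodule.one_le.1 le_rfl⟩
    | mul y z _ _ hy hz =>
      obtain ⟨n, hn⟩ := hy
      obtain ⟨m, hm⟩ := hz
      refine ⟨n + m, ?_⟩
      rw [Sdeg, pow_add]
      exact Submodule.mul_mem_mul hn hm
  exact Submodule.iSup_induction _ (motive := C) hmem hC (hC 0 0 (zero_mem _)) hadd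

theorem IsSymmAlg.linearMap_ext (hS : IsSymmAlg k L S ι) {F G : S →ₗ[k] S}
    (h : ∀ n, ∀ x ∈ Sdeg k L S ι n, F x = G x) : F = G :=
  LinearMap.ext fun x => hS.induction (C := fun x => F x = G x)
    (fun x y hx hy => by rw [map_add, map_add, hx, hy]) h x

variable [CharZero k]

/-- The components are determined by the total product. -/
theorem IsPBWComponents.eq_of_sum (hB : IsPBWComponents k L S ι e B)
    (he : IsSymmetrization k L S ι e) (hinj : Function.Injective e) {n m : ℕ} {x y : S}
    (hx : x ∈ Sdeg k L S ι n) (hy : y ∈ Sdeg k L S ι m) {w : ℕ → S}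
    (hw : ∀ p ≤ n + m, w p ∈ Sdeg k L S ι (n + m - p)) (hw' : ∀ p, n + m < p → w p = 0)
    (h : e x * e y = e (∑ p ∈ Finset.range (n + m + 1), w p)) (p : ℕ) : B p x y = w p := by
  rcases le_or_gt p (n + m) with hp | hp
  · exact he.eq_of_sum_eq hinj (z := fun p => B p x y) (fun p _ => hB.1 p n m x hx y hy) hw
      (hinj ((hB.2.2 n m x hx y hy).trans h)) hp
  · rw [hB.2.1 p n m hp x hx y hy, hw' p hp]

theorem IsPBWComponents.apply_algebraMap (hB : IsPBWComponents k L S ι e B)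
    (he : IsSymmetrization k L S ι e) (hinj : Function.Injective e) (hS : IsSymmAlg k L S ι)
    (c : k) (p : ℕ) :
    (B p).flip (algebraMap k S c) = (if p = 0 then c else 0) • LinearMap.id := by
  refine hS.linearMap_ext fun n x hx => ?_
  have h1 : e 1 = 1 := by simpa using he []
  have := hB.eq_of_sum he hinj (m := 0) (y := algebraMap k S c) hx
    (Submodule.algebraMap_mem c : _ ∈ (1 : Submodule k S))
    (w := fun p => (if p = 0 then c else 0) • x) (fun p _ => ?_) (fun p hp => ?_) ?_ p
  · rwa [LinearMap.flip_apply, LinearMap.smul_apply, LinearMap.id_apply]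
  · split_ifs with h0
    · subst h0; exact Submodule.smul_mem _ _ hx
    · simp
  · rw [if_neg (by omega), zero_smul]
  · simp only [ite_smul, zero_smul, Finset.sum_ite_eq', Finset.mem_range]
    rw [if_pos (by omega), Algebra.algebraMap_eq_smul_one, map_smul, map_smul, h1, mul_smul_comm,
      mul_one]

theorem IsPBWComponents.apply_pow_ι (hB : IsPBWComponents k L S ι e B)
    (he : IsSymmetrization k L S ι e) (hinj : Function.Injective e) (g z : L) (n p : ℕ) :
    B p (ι g ^ n) (ι z) = ((bernoulli p : k) * n.choose p) •
      (ι g ^ (n - p) * ι (((-LieAlgebra.ad k L g) ^ p) z)) := by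
  have h0 (p : ℕ) (hp : n < p) : ((bernoulli p : k) * n.choose p) •
      (ι g ^ (n - p) * ι (((-LieAlgebra.ad k L g) ^ p) z)) = 0 := by
    rw [Nat.choose_eq_zero_of_lt hp, Nat.cast_zero, mul_zero, zero_smul]
  refine hB.eq_of_sum he hinj (pow_ι_mem_Sdeg g n) (ι_mem_Sdeg z)
    (w := fun p => ((bernoulli p : k) * n.choose p) •
      (ι g ^ (n - p) * ι (((-LieAlgebra.ad k L g) ^ p) z))) (fun p hp => ?_) (fun p hp => ?_) ?_ p
  · rcases Nat.lt_or_ge n p with h | h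
    · simp only [h0 p h]
      exact zero_mem _
    · rw [Nat.sub_add_comm h]
      exact Submodule.smul_mem _ _ (mul_ι_mem_Sdeg (pow_ι_mem_Sdeg g _) _)
  · exact h0 p (by omega)
  · have hz : e (ι z) = UniversalEnvelopingAlgebra.ι k z := by simpa using he.apply_pow z 1
    rw [he.apply_pow, hz, he.pow_mul_ι, Finset.sum_range_succ _ (n + 1), h0 _ (by omega), add_zero]

theorem IsPBWComponents.zero_apply_ι (hB : IsPBWComponents k L S ι e B)
    (he : IsSymmetrization k L S ι e) (hinj : Function.Injective e) (hS : IsSymmAlg k L S ι)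
    (x : S) (z : L) : B 0 x (ι z) = x * ι z := by
  have : (B 0).flip (ι z) = LinearMap.mulRight k (ι z) := by
    refine hS.linearMap_ext fun n x hx => ?_
    replace hx := range_pow_le_span_pow ι n hx
    induction hx using Submodule.span_induction with
    | zero => simp
    | add x y _ _ hx hy => rw [map_add, map_add, hx, hy]
    | smul c x _ hx => rw [map_smul, map_smul, hx]
    | mem x hx =>
      obtain ⟨g, rfl⟩ := hx
      simp [hB.apply_pow_ι he hinj]
  simpa using LinearMap.congr_fun this x

theorem sum_alternating_choose_mul_choose {R : Type*} [CommRing R] (x : R) {m p : ℕ} (h : p < m) :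
    ∑ i ∈ Finset.range (m + 1), (m.choose i : R) * x ^ (m - i) * (-1) ^ i *
      ((i.choose p : R) * x ^ (i - p)) = 0 := by
  obtain ⟨q, rfl⟩ := Nat.exists_eq_add_of_le h.le
  have hq : q ≠ 0 := by omega
  rw [add_assoc, Finset.sum_range_add, Finset.sum_eq_zero, zero_add]
  · have h1 : ∀ j ∈ Finset.range (q + 1), ((p + q).choose (p + j) : R) * x ^ (p + q - (p + j)) *
        (-1) ^ (p + j) * (((p + j).choose p : R) * x ^ (p + j - p)) =
        (-1) ^ p * (p + q).choose p * x ^ q * (((-1) ^ j * q.choose j : ℤ) : R) := by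
      intro j hj
      have hj := Finset.mem_range.1 hj
      have h2 := Nat.choose_mul (n := p + q) (k := p + j) (s := p) (by omega)
      rw [Nat.add_sub_cancel_left, Nat.add_sub_cancel_left] at h2
      have h3 : ((p + q).choose (p + j) : R) * (p + j).choose p = (p + q).choose p * q.choose j := by
        rw [← Nat.cast_mul, ← Nat.cast_mul, h2]
      have h4 : x ^ q = x ^ (q - j) * x ^ j := by rw [← pow_add, Nat.sub_add_cancel (by omega)]
      rw [Nat.add_sub_add_left, Nat.add_sub_cancel_left, h4, pow_add]
      push_cast
      linear_combination x ^ (q - j) * x ^ j * (-1) ^ p * (-1) ^ j * h3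
    rw [Finset.sum_congr rfl h1, ← Finset.mul_sum, ← Int.cast_sum,
      Int.alternating_sum_range_choose, if_neg hq, Int.cast_zero, mul_zero]
  · intro i hi
    rw [Nat.choose_eq_zero_of_lt (Finset.mem_range.1 hi), Nat.cast_zero, zero_mul, mul_zero]

/-- Multiplication by a generator on the right has components of the expected order. -/
theorem IsPBWComponents.isDiffOpLT_ι (hB : IsPBWComponents k L S ι e B)
    (he : IsSymmetrization k L S ι e) (hinj : Function.Injective e) (hS : IsSymmAlg k L S ι)
    (z : L) (p : ℕ) : IsDiffOpLT (p + 1) ((B p).flip (ι z)) := by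
  refine isDiffOpLT_of_forall_pow hS fun m hm g => ?_
  rw [tensorDiff_apply, sub_eq_neg_add, add_pow, map_sum]
  have h : ∀ i ∈ Finset.range (m + 1), tensorEval ((B p).flip (ι z))
      ((-(1 ⊗ₜ[k] ι g)) ^ i * (ι g ⊗ₜ[k] 1) ^ (m - i) * ((m.choose i : ℕ) : S ⊗[k] S)) =
      ((m.choose i : S) * ι g ^ (m - i) * (-1) ^ i * ((i.choose p : S) * ι g ^ (i - p))) *
        ((bernoulli p : k) • ι (((-LieAlgebra.ad k L g) ^ p) z)) := by
    intro i _
    rw [neg_pow, mul_comm _ ((m.choose i : ℕ) : S ⊗[k] S), ← nsmul_eq_mul, map_nsmul,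
      Algebra.TensorProduct.tmul_pow, Algebra.TensorProduct.tmul_pow, mul_assoc,
      Algebra.TensorProduct.tmul_mul_tmul]
    rcases Nat.even_or_odd i with h' | h' <;>
      simp [h'.neg_one_pow, hB.apply_pow_ι he hinj, Algebra.smul_def] <;> ring
  rw [Finset.sum_congr rfl h, ← Finset.sum_mul, sum_alternating_choose_mul_choose _ hm, zero_mul]

/-- Associativity of the product, in components. -/
theorem IsPBWComponents.assoc (hB : IsPBWComponents k L S ι e B)
    (he : IsSymmetrization k L S ι e) (hinj : Function.Injective e)
    {n m l : ℕ} {x y z : S} (hx : x ∈ Sdeg k L S ι n) (hy : y ∈ Sdeg k L S ι m)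
    (hz : z ∈ Sdeg k L S ι l) (p : ℕ) :
    ∑ i ∈ Finset.range (p + 1), B (p - i) (B i x y) z =
      ∑ i ∈ Finset.range (p + 1), B (p - i) x (B i y z) := by
  have hl : ∀ i j, B j (B i x y) z ∈ Sdeg k L S ι (n + m + l - (i + j)) := by
    intro i j
    rcases le_or_gt i (n + m) with hi | hi
    · have := hB.1 j _ _ _ (hB.1 i _ _ x hx y hy) z hz
      rwa [show n + m - i + l - j = n + m + l - (i + j) by omega] at this
    · rw [hB.2.1 i n m hi x hx y hy]
      simp
  have hr : ∀ i j, B j x (B i y z) ∈ Sdeg k L S ι (n + m + l - (i + j)) := by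
    intro i j
    rcases le_or_gt i (m + l) with hi | hi
    · have := hB.1 j _ _ x hx _ (hB.1 i _ _ y hy z hz)
      rwa [show n + (m + l - i) - j = n + m + l - (i + j) by omega] at this
    · rw [hB.2.1 i m l hi y hy z hz]
      simp
  rcases le_or_gt p (n + m + l) with hp | hp
  · refine he.eq_of_sum_eq hinj (D := n + m + l)
      (z := fun p => ∑ i ∈ Finset.range (p + 1), B (p - i) (B i x y) z)
      (w := fun p => ∑ i ∈ Finset.range (p + 1), B (p - i) x (B i y z))
      (fun p _ => Submodule.sum_mem _ fun i hi => ?_)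
      (fun p _ => Submodule.sum_mem _ fun i hi => ?_) (hinj ?_) hp
    · have hi := Finset.mem_range.1 hi
      have := hl i (p - i)
      rwa [Nat.add_sub_cancel' (by omega)] at this
    · have hi := Finset.mem_range.1 hi
      have := hr i (p - i)
      rwa [Nat.add_sub_cancel' (by omega)] at this
    · have h1 : ∀ i ∈ Finset.range (n + m + l + 1),
          e (∑ j ∈ Finset.range (n + m + l + 1 - i), B j (B i x y) z) =
            e (B i x y) * e z := by
        intro i hi
        have hi := Finset.mem_range.1 hi
        rcases le_or_gt i (n + m) with hi' | hi'
        · rw [← hB.2.2 _ _ _ (hB.1 i _ _ x hx y hy) z hz,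
            show n + m - i + l + 1 = n + m + l + 1 - i by omega]
        · simp [hB.2.1 i n m hi' x hx y hy]
      have h2 : ∀ i ∈ Finset.range (n + m + l + 1),
          e (∑ j ∈ Finset.range (n + m + l + 1 - i), B j x (B i y z)) =
            e x * e (B i y z) := by
        intro i hi
        have hi := Finset.mem_range.1 hi
        rcases le_or_gt i (m + l) with hi' | hi'
        · rw [← hB.2.2 _ _ x hx _ (hB.1 i _ _ y hy z hz),
            show n + (m + l - i) + 1 = n + m + l + 1 - i by omega]
        · simp [hB.2.1 i m l hi' y hy z hz]
      have h3 {a b c : ℕ} {u v : S} (hu : u ∈ Sdeg k L S ι a) (hv : v ∈ Sdeg k L S ι b)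
          (hab : a + b ≤ c) : e (∑ i ∈ Finset.range (c + 1), B i u v) = e u * e v := by
        rw [← hB.2.2 a b u hu v hv]
        congr 1
        symm
        refine Finset.sum_subset (Finset.range_mono (by omega)) fun i _ hi => ?_
        exact hB.2.1 i a b (by have := Finset.mem_range.not.1 hi; omega) u hu v hv
      rw [Finset.sum_range_diag_flip _ fun i j => B j (B i x y) z,
        Finset.sum_range_diag_flip _ fun i j => B j x (B i y z), map_sum, map_sum,
        Finset.sum_congr rfl h1, Finset.sum_congr rfl h2, ← Finset.sum_mul, ← Finset.mul_sum,
        ← map_sum, ← map_sum, h3 hx hy (by omega), h3 hy hz (by omega), mul_assoc]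
  · rw [Finset.sum_eq_zero, Finset.sum_eq_zero]
    · intro i hi
      have hi := Finset.mem_range.1 hi
      rcases le_or_gt i (m + l) with hi' | hi'
      · exact hB.2.1 _ _ _ (by omega) x hx _ (hB.1 i _ _ y hy z hz)
      · simp [hB.2.1 i m l hi' y hy z hz]
    · intro i hi
      have hi := Finset.mem_range.1 hi
      rcases le_or_gt i (n + m) with hi' | hi'
      · exact hB.2.1 _ _ _ (by omega) _ (hB.1 i _ _ x hx y hy) z hz
      · simp [hB.2.1 i n m hi' x hx y hy]

theorem IsPBWComponents.isDiffOpLT_of_mem_Sdeg (hB : IsPBWComponents k L S ι e B)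
    (he : IsSymmetrization k L S ι e) (hinj : Function.Injective e) (hS : IsSymmAlg k L S ι)
    (m : ℕ) : ∀ a ∈ Sdeg k L S ι m, ∀ p, IsDiffOpLT (p + 1) ((B p).flip a) := by
  induction m using Nat.strong_induction_on with
  | _ m ih =>
    intro a ha
    rcases m with _ | m
    · obtain ⟨c, rfl⟩ := Submodule.mem_one.1 (by simpa [Sdeg] using ha)
      intro p
      rw [hB.apply_algebraMap he hinj hS]
      exact (isDiffOpLT_one_smul_id _).mono (by omega)
    · rw [Sdeg, pow_succ] at ha
      induction ha using Submodule.mul_induction_on' with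
      | add x _ y _ hx hy => intro p; rw [map_add]; exact (hx p).add (hy p)
      | mem_mul_mem x hx y hy =>
        obtain ⟨z, rfl⟩ := hy
        intro p
        have key : (B p).flip (x * ι z) =
            ∑ i ∈ Finset.range (p + 1), (B (p - i)).flip (ι z) ∘ₗ (B i).flip x -
              ∑ i ∈ Finset.range p, (B (p - (i + 1))).flip (B (i + 1) x (ι z)) := by
          refine hS.linearMap_ext fun n y hy => ?_
          have h := hB.assoc he hinj hy hx (ι_mem_Sdeg z) p
          rw [Finset.sum_range_succ' (fun i => B (p - i) y (B i x (ι z))) p] at h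
          simp only [LinearMap.sub_apply, LinearMap.sum_apply, LinearMap.comp_apply,
            LinearMap.flip_apply]
          rw [eq_sub_iff_add_eq', h, Nat.sub_zero, hB.zero_apply_ι he hinj hS]
        rw [key]
        refine IsDiffOpLT.sub (IsDiffOpLT.sum fun i hi => ?_) (IsDiffOpLT.sum fun i hi => ?_)
        · have hi := Finset.mem_range.1 hi
          refine ((hB.isDiffOpLT_ι he hinj hS z (p - i)).comp (ih m (by omega) x hx i)).mono ?_
          omega
        · exact (ih _ (by omega) _ (hB.1 (i + 1) m 1 x hx _ (ι_mem_Sdeg z)) _).mono (by omega)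

end Components

/-- Theorem 2.2 of the paper (second case): for `a ∈ S𝔤` and `p ≥ 1`, the `k`-linear
endomorphism `x ↦ B_p(x, a)` of the symmetric algebra is a differential operator of
order `≤ p`. -/
theorem Bp_right_is_diffOp (k : Type) [Field k] [CharZero k]
    (L : Type) [LieRing L] [LieAlgebra k L]
    (S : Type) [CommRing S] [Algebra k S] (ι : L →ₗ[k] S)
    (hS : IsSymmAlg k L S ι)
    (e : S →ₗ[k] UniversalEnvelopingAlgebra k L)
    (he : IsSymmetrization k L S ι e) (hbij : Function.Bijective e)
    (B : ℕ → S →ₗ[k] S →ₗ[k] S) (hB : IsPBWComponents k L S ι e B)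
    (a : S) (p : ℕ) (hp : 1 ≤ p) :
    IsDiffOpOrderLE k S p ((B p).flip a) := by
  exact (hS.induction (C := fun a => IsDiffOpLT (p + 1) ((B p).flip a))
    (fun x y hx hy => by rw [map_add]; exact hx.add hy)
    (fun n x hx => hB.isDiffOpLT_of_mem_Sdeg he hbij.injective hS n x hx p) a).isDiffOpOrderLE

end
end

section
/- Let 𝔤 be a Lie algebra over k. Then B_1(x,y) = (1/2){x,y} for all x, y ∈ S𝔤, where {,} is the Poisson bracket on S𝔤 induced by the Lie bracket of 𝔤. Explicitly, for x_1,…,x_n, y_1,…,y_m ∈ 𝔤: B_1(x_1⋯x_n, y_1⋯y_m) = (1/2) Σ_{i=1}^n Σ_{j=1}^m x_1⋯x̂_i⋯x_n · y_1⋯ŷ_j⋯y_m · [x_i, y_j], where x̂_i (resp. ŷ_j) means that the factor x_i (resp. y_j) is omitted. -/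
noncomputable section

/-- The span of the products of at most `N - d` elements of the image of `f`; it is zero for
`N < d`. -/
def wordSpan (k : Type) [Field k] {L A : Type} [Ring A] [Algebra k A] (f : L → A) (d N : ℕ) :
    Submodule k A :=
  Submodule.span k {a | ∃ l : List L, l.length + d ≤ N ∧ (l.map f).prod = a}

section WordSpan

variable {k : Type} [Field k] {L A : Type} [Ring A] [Algebra k A] {f : L → A}

lemma prod_mem_wordSpan {d N : ℕ} (l : List L) (h : l.length + d ≤ N) :
    (l.map f).prod ∈ wordSpan k f d N :=
  Submodule.subset_span ⟨l, h, rfl⟩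

lemma mem_wordSpan_one (x : L) : f x ∈ wordSpan k f 0 1 := by
  simpa using prod_mem_wordSpan (k := k) (f := f) (d := 0) (N := 1) [x] (by simp)

lemma wordSpan_mono {d N d' N' : ℕ} (h : N + d' ≤ N' + d) :
    wordSpan k f d N ≤ wordSpan k f d' N' := by
  refine Submodule.span_le.2 ?_
  rintro _ ⟨l, hl, rfl⟩
  exact prod_mem_wordSpan l (by omega)

lemma mul_mem_wordSpan {d N d' N' D M : ℕ} {a b : A} (ha : a ∈ wordSpan k f d N)
    (hb : b ∈ wordSpan k f d' N') (h : N + N' + D ≤ M + d + d') :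
    a * b ∈ wordSpan k f D M := by
  have hmul := Submodule.mul_mem_mul ha hb
  rw [wordSpan, wordSpan, Submodule.span_mul_span] at hmul
  refine Submodule.span_le.2 ?_ hmul
  rintro _ ⟨_, ⟨l, hl, rfl⟩, _, ⟨l', hl', rfl⟩, rfl⟩
  have := prod_mem_wordSpan (k := k) (f := f) (d := D) (N := M) (l ++ l') (by simp; omega)
  simpa using this

/-- A function on words that is permutation invariant modulo `W` agrees modulo `W` with its
average over all permutations. -/
lemma sub_average_mem [CharZero k] {W : Submodule k A} (F : List L → A)
    (hF : ∀ l l' : List L, l.Perm l' → F l - F l' ∈ W) (l : List L) :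
    F l - ((l.length.factorial : k)⁻¹) •
      ∑ σ : Equiv.Perm (Fin l.length), F (List.ofFn fun i => l.get (σ i)) ∈ W := by
  have hne : (l.length.factorial : k) ≠ 0 := by exact_mod_cast Nat.factorial_ne_zero _
  have key : F l - ((l.length.factorial : k)⁻¹) •
      ∑ σ : Equiv.Perm (Fin l.length), F (List.ofFn fun i => l.get (σ i)) =
      ((l.length.factorial : k)⁻¹) •
      ∑ σ : Equiv.Perm (Fin l.length), (F l - F (List.ofFn fun i => l.get (σ i))) := by
    rw [Finset.sum_sub_distrib, smul_sub, Finset.sum_const, Finset.card_univ, Fintype.card_perm,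
      Fintype.card_fin, ← Nat.cast_smul_eq_nsmul k, smul_smul, inv_mul_cancel₀ hne, one_smul]
  rw [key]
  refine W.smul_mem _ (W.sum_mem fun σ _ => hF _ _ ?_)
  have := (σ.ofFn_comp_perm l.get).symm
  rwa [List.ofFn_get] at this

end WordSpan

section Polarization

variable {k : Type} [Field k] [CharZero k]

/-- If a polynomial with coefficients in a vector space takes all its values in a subspace, then
its coefficients lie in this subspace. -/
lemma coeff_mem_of_forall_sum_mem {M : Type} [AddCommGroup M] [Module k M] (W : Submodule k M)
    (n : ℕ) (c : ℕ → M) (h : ∀ t : k, ∑ i ∈ Finset.range n, t ^ i • c i ∈ W) (i : ℕ)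
    (hi : i < n) : c i ∈ W := by
  by_contra hc
  obtain ⟨f, hf, hW⟩ := Submodule.exists_le_ker_of_notMem hc
  let p : Polynomial k := ∑ j ∈ Finset.range n, Polynomial.monomial j (f (c j))
  have hp : p = 0 := by
    refine Polynomial.funext fun t => ?_
    have h0 : f (∑ j ∈ Finset.range n, t ^ j • c j) = 0 := hW (h t)
    simp only [map_sum, map_smul, smul_eq_mul] at h0
    simp only [p, Polynomial.eval_finsetSum, Polynomial.eval_monomial, Polynomial.eval_zero]
    rw [← h0]
    exact Finset.sum_congr rfl fun j _ => mul_comm _ _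
  apply hf
  have := congrArg (fun q => Polynomial.coeff q i) hp
  simpa [p, Polynomial.finsetSum_coeff, Polynomial.coeff_monomial, hi] using this

variable {L : Type} [AddCommGroup L] [Module k L] {S : Type} [CommRing S] [Algebra k S]

lemma pow_mul_mem_span_pow (ι : L →ₗ[k] S) (n : ℕ) (g h : L) :
    ι g ^ n * ι h ∈ Submodule.span k (Set.range fun x => ι x ^ (n + 1)) := by
  have := coeff_mem_of_forall_sum_mem (Submodule.span k (Set.range fun x => ι x ^ (n + 1)))
    (n + 1 + 1) (fun i => (ι h ^ i * ι g ^ (n + 1 - i) * ((n + 1).choose i : S))) (fun t => by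
      have ht : ι (t • h + g) ^ (n + 1) ∈
          Submodule.span k (Set.range fun x => ι x ^ (n + 1)) :=
        Submodule.subset_span ⟨_, rfl⟩
      rw [map_add, map_smul, add_pow] at ht
      simpa [smul_pow] using ht) 1 (by omega)
  have hne : ((n : k) + 1) ≠ 0 := by exact_mod_cast n.succ_ne_zero
  have h2 := Submodule.smul_mem _ ((n : k) + 1)⁻¹ this
  convert h2 using 1
  have : ((n + 1).choose 1 : S) = algebraMap k S ((n : k) + 1) := by simp
  simp only [this, pow_one, Nat.add_sub_cancel]
  rw [mul_comm _ (algebraMap k S _), ← Algebra.smul_def, smul_smul, inv_mul_cancel₀ hne, one_smul,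
    mul_comm]

lemma range_pow_le_span_pow_s9 (ι : L →ₗ[k] S) (n : ℕ) :
    LinearMap.range ι ^ n ≤ Submodule.span k (Set.range fun x => ι x ^ n) := by
  induction n with
  | zero =>
    rw [pow_zero, Submodule.one_eq_span]
    exact Submodule.span_mono (by rintro _ rfl; exact ⟨0, by simp⟩)
  | succ n ih =>
    rw [pow_succ, Submodule.mul_le]
    rintro x hx y hy
    obtain ⟨h, rfl⟩ := LinearMap.mem_range.1 hy
    have hle : Submodule.span k (Set.range fun x => ι x ^ n) ≤
        (Submodule.span k (Set.range fun x => ι x ^ (n + 1))).comap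
          (LinearMap.mulRight k (ι h)) := by
      refine Submodule.span_le.2 ?_
      rintro _ ⟨g, rfl⟩
      exact pow_mul_mem_span_pow ι n g h
    exact hle (ih hx)

end Polarization

section Adams

attribute [local instance] LieRing.ofAssociativeRing

variable {k : Type} [Field k] {L : Type} [LieRing L] [LieAlgebra k L]

open scoped TensorProduct

/-- The comultiplication of the enveloping algebra, for which the elements of the Lie algebra are
primitive. -/
def envelopingComul (k : Type) [Field k] (L : Type) [LieRing L] [LieAlgebra k L] :
    UniversalEnvelopingAlgebra k L →ₐ[k]
      UniversalEnvelopingAlgebra k L ⊗[k] UniversalEnvelopingAlgebra k L :=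
  UniversalEnvelopingAlgebra.lift k
    { toFun := fun x => UniversalEnvelopingAlgebra.ι k x ⊗ₜ 1 +
        1 ⊗ₜ UniversalEnvelopingAlgebra.ι k x
      map_add' := fun x y => by
        simp only [map_add, TensorProduct.add_tmul, TensorProduct.tmul_add]; abel
      map_smul' := fun c x => by
        simp [TensorProduct.smul_tmul', TensorProduct.tmul_smul]
      map_lie' := fun {x y} => by
        simp only [LieHom.map_lie, LieRing.of_associative_ring_bracket, TensorProduct.sub_tmul,
          TensorProduct.tmul_sub, mul_add, add_mul, Algebra.TensorProduct.tmul_mul_tmul, one_mul,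
          mul_one]
        abel }

/-- The second Adams operation: comultiplication followed by multiplication. -/
def adamsTwo (k : Type) [Field k] (L : Type) [LieRing L] [LieAlgebra k L] :
    UniversalEnvelopingAlgebra k L →ₗ[k] UniversalEnvelopingAlgebra k L :=
  LinearMap.mul' k _ ∘ₗ (envelopingComul k L).toLinearMap

lemma adamsTwo_pow (x : L) (n : ℕ) :
    adamsTwo k L (UniversalEnvelopingAlgebra.ι k x ^ n) =
      (2 : k) ^ n • UniversalEnvelopingAlgebra.ι k x ^ n := by
  have h1 : envelopingComul k L (UniversalEnvelopingAlgebra.ι k x) =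
      UniversalEnvelopingAlgebra.ι k x ⊗ₜ 1 + 1 ⊗ₜ UniversalEnvelopingAlgebra.ι k x :=
    UniversalEnvelopingAlgebra.lift_ι_apply' k _ x
  have hc : Commute (UniversalEnvelopingAlgebra.ι k x ⊗ₜ[k] (1 : UniversalEnvelopingAlgebra k L))
      (1 ⊗ₜ UniversalEnvelopingAlgebra.ι k x) := by
    simp [Commute, SemiconjBy]
  rw [adamsTwo, LinearMap.comp_apply, AlgHom.toLinearMap_apply, map_pow, h1, hc.add_pow, map_sum]
  have h2 : ∀ i ∈ Finset.range (n + 1), LinearMap.mul' k (UniversalEnvelopingAlgebra k L)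
      ((UniversalEnvelopingAlgebra.ι k x ⊗ₜ[k] (1 : UniversalEnvelopingAlgebra k L)) ^ i *
      (1 ⊗ₜ UniversalEnvelopingAlgebra.ι k x) ^ (n - i) *
        ((n.choose i : ℕ) : UniversalEnvelopingAlgebra k L ⊗[k] UniversalEnvelopingAlgebra k L)) =
      (n.choose i : k) • UniversalEnvelopingAlgebra.ι k x ^ n := by
    intro i hi
    rw [← nsmul_eq_mul', map_nsmul, Nat.cast_smul_eq_nsmul]
    have := Finset.mem_range.1 hi
    simp [← pow_add, show i + (n - i) = n by omega]
  rw [Finset.sum_congr rfl h2, ← Finset.sum_smul]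
  congr 1
  have h3 := congrArg (Nat.cast (R := k)) (Nat.sum_range_choose n)
  simpa using h3

lemma ι_mul_sub_swap (x y : L) (u : UniversalEnvelopingAlgebra k L) :
    UniversalEnvelopingAlgebra.ι k x * (UniversalEnvelopingAlgebra.ι k y * u) -
      UniversalEnvelopingAlgebra.ι k y * (UniversalEnvelopingAlgebra.ι k x * u) =
      UniversalEnvelopingAlgebra.ι k ⁅x, y⁆ * u := by
  rw [LieHom.map_lie, LieRing.of_associative_ring_bracket]
  noncomm_ring

end Adams

section Symmetrization

variable {k : Type} [Field k] {L : Type} [LieRing L] [LieAlgebra k L]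
  {S : Type} [CommRing S] [Algebra k S] {ι : L →ₗ[k] S}
  {e : S →ₗ[k] UniversalEnvelopingAlgebra k L}

lemma symmetrization_prod (he : IsSymmetrization k L S ι e) (l : List L) :
    e (l.map ι).prod = ((l.length.factorial : k)⁻¹) •
      ∑ σ : Equiv.Perm (Fin l.length),
        ((List.ofFn fun i => l.get (σ i)).map (UniversalEnvelopingAlgebra.ι k)).prod := by
  rw [he l]
  simp only [List.map_ofFn]
  rfl

lemma symmetrization_mem (he : IsSymmetrization k L S ι e) {d N : ℕ} {s : S}
    (hs : s ∈ wordSpan k ι d N) :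
    e s ∈ wordSpan k (UniversalEnvelopingAlgebra.ι k : L → _) d N := by
  have : wordSpan k ι d N ≤
      (wordSpan k (UniversalEnvelopingAlgebra.ι k : L → _) d N).comap e := by
    refine Submodule.span_le.2 ?_
    rintro _ ⟨l, hl, rfl⟩
    rw [SetLike.mem_coe, Submodule.mem_comap, symmetrization_prod he]
    exact Submodule.smul_mem _ _ (Submodule.sum_mem _ fun σ _ => prod_mem_wordSpan _ (by simpa))
  exact this hs

lemma word_sub_word_mem_of_perm {l l' : List L} (h : l.Perm l') :
    (l.map (UniversalEnvelopingAlgebra.ι k)).prod -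
      (l'.map (UniversalEnvelopingAlgebra.ι k)).prod ∈
      wordSpan k (UniversalEnvelopingAlgebra.ι k : L → _) 1 l.length := by
  induction h with
  | nil => simp
  | cons x h ih =>
    simp only [List.map_cons, List.prod_cons, ← mul_sub, List.length_cons]
    exact mul_mem_wordSpan (mem_wordSpan_one x) ih (by omega)
  | swap x y l =>
    simp only [List.map_cons, List.prod_cons, ι_mul_sub_swap, List.length_cons]
    exact mul_mem_wordSpan (mem_wordSpan_one _) (prod_mem_wordSpan (d := 0) l le_rfl) (by omega)
  | trans h₁ _ ih₁ ih₂ =>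
    rw [← h₁.length_eq] at ih₂
    simpa using add_mem ih₁ ih₂

variable [CharZero k]

lemma symmetrization_pow (he : IsSymmetrization k L S ι e) (x : L) (n : ℕ) :
    e (ι x ^ n) = UniversalEnvelopingAlgebra.ι k x ^ n := by
  have h := he (List.replicate n x)
  have hne : (n.factorial : k) ≠ 0 := by exact_mod_cast Nat.factorial_ne_zero _
  simp only [List.map_replicate, List.prod_replicate, List.get_eq_getElem, List.getElem_replicate,
    List.ofFn_const, List.length_replicate, Finset.sum_const, Finset.card_univ, Fintype.card_perm,
    Fintype.card_fin] at h
  rw [h, ← Nat.cast_smul_eq_nsmul k, smul_smul, inv_mul_cancel₀ hne, one_smul]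

/-- The homogeneous components of the symmetric algebra are linearly independent: the
symmetrization map sends them to eigenspaces of an Adams operation for distinct eigenvalues. -/
lemma iSupIndep_Sdeg (he : IsSymmetrization k L S ι e) (hbij : Function.Bijective e) :
    iSupIndep (Sdeg k L S ι) := by
  let E := LinearEquiv.ofBijective e hbij
  let θ : Module.End k S := E.symm.toLinearMap ∘ₗ adamsTwo k L ∘ₗ e
  have hinj : Function.Injective fun n : ℕ => (2 : k) ^ n := fun a b h => by
    have : 2 ^ a = 2 ^ b := by exact_mod_cast (show (2 : k) ^ a = 2 ^ b from h)
    exact Nat.pow_right_injective le_rfl this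
  refine (θ.eigenspaces_iSupIndep.comp hinj).mono fun n => ?_
  refine (range_pow_le_span_pow_s9 ι n).trans (Submodule.span_le.2 ?_)
  rintro _ ⟨x, rfl⟩
  refine Module.End.mem_eigenspace_iff.2 (hbij.1 ?_)
  have hE : ∀ u, e (E.symm u) = u := E.apply_symm_apply
  simp only [θ, LinearMap.comp_apply, LinearEquiv.coe_coe, hE, symmetrization_pow he, adamsTwo_pow,
    map_smul]

lemma word_sub_symmetrization_mem (he : IsSymmetrization k L S ι e) (l : List L) :
    (l.map (UniversalEnvelopingAlgebra.ι k)).prod - e (l.map ι).prod ∈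
      wordSpan k (UniversalEnvelopingAlgebra.ι k : L → _) 1 l.length := by
  rw [symmetrization_prod he]
  have := sub_average_mem (k := k)
    (W := wordSpan k (UniversalEnvelopingAlgebra.ι k : L → _) 1 l.length)
    (fun l' => if l'.length = l.length then (l'.map (UniversalEnvelopingAlgebra.ι k)).prod else 0)
    (fun a b h => by
      simp only [h.length_eq]
      split_ifs with hb
      · rw [← hb, ← h.length_eq]
        exact word_sub_word_mem_of_perm h
      · simp) l
  simpa using this

lemma symmetrization_mul_sub_mem (he : IsSymmetrization k L S ι e) {d N d' N' : ℕ} {s t : S}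
    (hs : s ∈ wordSpan k ι d N) (ht : t ∈ wordSpan k ι d' N') :
    e s * e t - e (s * t) ∈
      wordSpan k (UniversalEnvelopingAlgebra.ι k : L → _) (d + d' + 1) (N + N') := by
  induction hs, ht using Submodule.span_induction₂ with
  | mem_mem x y hx hy =>
    obtain ⟨a, ha, rfl⟩ := hx
    obtain ⟨b, hb, rfl⟩ := hy
    have h1 := word_sub_symmetrization_mem he a
    have h2 := word_sub_symmetrization_mem he b
    have h3 := word_sub_symmetrization_mem he (a ++ b)
    have h4 := mul_mem_wordSpan (D := d + d' + 1) (M := N + N') h1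
      (symmetrization_mem he (prod_mem_wordSpan (k := k) (f := ι) (d := 0) b le_rfl)) (by omega)
    have h5 := mul_mem_wordSpan (D := d + d' + 1) (M := N + N')
      (prod_mem_wordSpan (k := k) (f := UniversalEnvelopingAlgebra.ι k) (d := 0) a le_rfl) h2
      (by omega)
    have h6 := wordSpan_mono (d' := d + d' + 1) (N' := N + N') (by simp; omega) h3
    simp only [List.map_append, List.prod_append] at h6
    convert sub_mem (sub_mem h6 h4) h5 using 1
    noncomm_ring
  | zero_left => simp
  | zero_right => simp
  | add_left x y z _ _ _ h1 h2 =>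
    convert add_mem h1 h2 using 1
    simp only [add_mul, map_add]; abel
  | add_right x y z _ _ _ h1 h2 =>
    convert add_mem h1 h2 using 1
    simp only [mul_add, map_add]; abel
  | smul_left r x y _ _ h =>
    convert Submodule.smul_mem _ r h using 1
    simp [smul_sub]
  | smul_right r x y _ _ h =>
    convert Submodule.smul_mem _ r h using 1
    simp [smul_sub]

lemma ι_mul_symmetrization_sub_mem (he : IsSymmetrization k L S ι e) {d N : ℕ} (x : L) {s : S}
    (hs : s ∈ wordSpan k ι d N) :
    UniversalEnvelopingAlgebra.ι k x * e s - e (ι x * s) ∈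
      wordSpan k (UniversalEnvelopingAlgebra.ι k : L → _) (d + 1) (N + 1) := by
  have h := symmetrization_mul_sub_mem he (mem_wordSpan_one (k := k) (f := ι) x) hs
  have hx : e (ι x) = UniversalEnvelopingAlgebra.ι k x := by
    simpa using symmetrization_pow he x 1
  rw [hx] at h
  exact wordSpan_mono (by omega) h

lemma wordSpan_le_map (he : IsSymmetrization k L S ι e) (d N : ℕ) :
    wordSpan k (UniversalEnvelopingAlgebra.ι k : L → _) d N ≤ (wordSpan k ι d N).map e := by
  have key : ∀ n : ℕ, ∀ l : List L, l.length ≤ n →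
      (l.map (UniversalEnvelopingAlgebra.ι k)).prod ∈ (wordSpan k ι 0 l.length).map e := by
    intro n
    induction n with
    | zero =>
      intro l hl
      obtain rfl : l = [] := List.length_eq_zero_iff.1 (by omega)
      refine ⟨_, prod_mem_wordSpan [] le_rfl, ?_⟩
      simpa using symmetrization_pow he 0 0
    | succ n ih =>
      intro l hl
      have h1 : wordSpan k (UniversalEnvelopingAlgebra.ι k : L → _) 1 l.length ≤
          (wordSpan k ι 0 l.length).map e := by
        refine Submodule.span_le.2 ?_
        rintro _ ⟨l', hl', rfl⟩
        exact Submodule.map_mono (wordSpan_mono (by omega)) (ih l' (by omega))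
      have h2 := h1 (word_sub_symmetrization_mem he l)
      have h3 := Submodule.mem_map_of_mem (f := e)
        (prod_mem_wordSpan (k := k) (f := ι) (d := 0) l le_rfl)
      simpa using add_mem h2 h3
  refine Submodule.span_le.2 ?_
  rintro _ ⟨l, hl, rfl⟩
  exact Submodule.map_mono (wordSpan_mono (by omega)) (key _ l le_rfl)

end Symmetrization

section Poisson

variable {k : Type} [Field k] {L : Type} [LieRing L] [LieAlgebra k L]
  {S : Type} [CommRing S] [Algebra k S] {ι : L →ₗ[k] S} {P : S →ₗ[k] S →ₗ[k] S}

/-- The sum over all pairs `i < j` of letters of a word of the bracket of these letters times the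
product of the other letters. -/
def wordBracket (ι : L →ₗ[k] S) (P : S →ₗ[k] S →ₗ[k] S) : List L → S
  | [] => 0
  | x :: l => P (ι x) (l.map ι).prod + ι x * wordBracket ι P l

lemma poisson_one_left (hP2 : ∀ a b c : S, P (a * b) c = a * P b c + b * P a c) (c : S) :
    P 1 c = 0 := by
  simpa using hP2 1 1 c

lemma poisson_one_right (hP3 : ∀ a b c : S, P a (b * c) = b * P a c + c * P a b) (c : S) :
    P c 1 = 0 := by
  simpa using hP3 c 1 1

lemma poisson_ι_prod_mem (hP1 : ∀ g h : L, P (ι g) (ι h) = ι ⁅g, h⁆)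
    (hP3 : ∀ a b c : S, P a (b * c) = b * P a c + c * P a b) (g : L) (l : List L) :
    P (ι g) (l.map ι).prod ∈ wordSpan k ι 0 l.length := by
  induction l with
  | nil => simp [poisson_one_right hP3]
  | cons x l ih =>
    rw [List.map_cons, List.prod_cons, hP3, hP1]
    exact add_mem (mul_mem_wordSpan (mem_wordSpan_one x) ih (by simp; omega))
      (mul_mem_wordSpan (prod_mem_wordSpan (d := 0) l le_rfl) (mem_wordSpan_one _) (by simp))

lemma wordBracket_mem (hP1 : ∀ g h : L, P (ι g) (ι h) = ι ⁅g, h⁆)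
    (hP3 : ∀ a b c : S, P a (b * c) = b * P a c + c * P a b) (l : List L) :
    wordBracket ι P l ∈ wordSpan k ι 1 l.length := by
  induction l with
  | nil => simp [wordBracket]
  | cons x l ih =>
    exact add_mem (wordSpan_mono (by simp) (poisson_ι_prod_mem hP1 hP3 x l))
      (mul_mem_wordSpan (mem_wordSpan_one x) ih (by simp; omega))

lemma wordBracket_append (hP2 : ∀ a b c : S, P (a * b) c = a * P b c + b * P a c)
    (hP3 : ∀ a b c : S, P a (b * c) = b * P a c + c * P a b) (a b : List L) :
    wordBracket ι P (a ++ b) = wordBracket ι P a * (b.map ι).prod +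
      (a.map ι).prod * wordBracket ι P b + P (a.map ι).prod (b.map ι).prod := by
  induction a with
  | nil => simp [wordBracket, poisson_one_left hP2]
  | cons x a ih =>
    simp only [List.cons_append, wordBracket, ih, List.map_append, List.prod_append, List.map_cons,
      List.prod_cons, hP3, hP2]
    ring

lemma poisson_prod_ι (hP1 : ∀ g h : L, P (ι g) (ι h) = ι ⁅g, h⁆)
    (hP2 : ∀ a b c : S, P (a * b) c = a * P b c + b * P a c)
    (hP3 : ∀ a b c : S, P a (b * c) = b * P a c + c * P a b) (l : List L) (x : L) :
    P (l.map ι).prod (ι x) = -P (ι x) (l.map ι).prod := by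
  induction l with
  | nil => simp [poisson_one_left hP2, poisson_one_right hP3]
  | cons y l ih =>
    rw [List.map_cons, List.prod_cons, hP3, hP2, ih, hP1, hP1, ← lie_skew x y, map_neg]
    ring

lemma wordBracket_reverse (hP1 : ∀ g h : L, P (ι g) (ι h) = ι ⁅g, h⁆)
    (hP2 : ∀ a b c : S, P (a * b) c = a * P b c + b * P a c)
    (hP3 : ∀ a b c : S, P a (b * c) = b * P a c + c * P a b) (l : List L) :
    wordBracket ι P l.reverse = -wordBracket ι P l := by
  induction l with
  | nil => simp [wordBracket]
  | cons x l ih =>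
    have hr : (l.reverse.map ι).prod = (l.map ι).prod := (l.reverse_perm.map ι).prod_eq
    have hx : wordBracket ι P [x] = 0 := by simp [wordBracket, poisson_one_right hP3]
    have h1 : ([x].map ι).prod = ι x := by simp
    rw [List.reverse_cons, wordBracket_append hP2 hP3, ih, hx, h1, poisson_prod_ι hP1 hP2 hP3, hr,
      wordBracket]
    ring

lemma reverse_ofFn_eq {α : Type} {n : ℕ} (f : Fin n → α) :
    (List.ofFn f).reverse = List.ofFn fun i => f i.rev := by
  refine List.ext_getElem (by simp) fun i h1 h2 => ?_
  simp only [List.getElem_reverse, List.getElem_ofFn, List.length_ofFn]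
  congr 1
  ext
  simp [Fin.rev]
  omega

lemma sum_wordBracket_perm [CharZero k] (hP1 : ∀ g h : L, P (ι g) (ι h) = ι ⁅g, h⁆)
    (hP2 : ∀ a b c : S, P (a * b) c = a * P b c + b * P a c)
    (hP3 : ∀ a b c : S, P a (b * c) = b * P a c + c * P a b) (l : List L) :
    ∑ σ : Equiv.Perm (Fin l.length), wordBracket ι P (List.ofFn fun i => l.get (σ i)) = 0 := by
  have h := Equiv.sum_comp (Equiv.mulRight (Fin.revPerm : Equiv.Perm (Fin l.length)))
    fun σ => wordBracket ι P (List.ofFn fun i => l.get (σ i))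
  have h2 : ∀ σ : Equiv.Perm (Fin l.length),
      wordBracket ι P (List.ofFn fun i => l.get (Equiv.mulRight Fin.revPerm σ i)) =
        -wordBracket ι P (List.ofFn fun i => l.get (σ i)) := fun σ => by
    rw [← wordBracket_reverse hP1 hP2 hP3, reverse_ofFn_eq]
    rfl
  simp only [h2, Finset.sum_neg_distrib] at h
  have h3 : (2 : k) • ∑ σ : Equiv.Perm (Fin l.length),
      wordBracket ι P (List.ofFn fun i => l.get (σ i)) = 0 := by
    rw [two_smul]
    nth_rw 1 [← h]
    exact neg_add_cancel _
  exact (smul_eq_zero.1 h3).resolve_left two_ne_zero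

variable [CharZero k] {e : S →ₗ[k] UniversalEnvelopingAlgebra k L}

lemma corrected_word_sub_mem_of_perm (he : IsSymmetrization k L S ι e)
    (hP1 : ∀ g h : L, P (ι g) (ι h) = ι ⁅g, h⁆)
    (hP3 : ∀ a b c : S, P a (b * c) = b * P a c + c * P a b) {l l' : List L} (h : l.Perm l') :
    ((l.map (UniversalEnvelopingAlgebra.ι k)).prod - (2 : k)⁻¹ • e (wordBracket ι P l)) -
      ((l'.map (UniversalEnvelopingAlgebra.ι k)).prod - (2 : k)⁻¹ • e (wordBracket ι P l')) ∈
      wordSpan k (UniversalEnvelopingAlgebra.ι k : L → _) 2 l.length := by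
  induction h with
  | nil => simp
  | @cons x l l' h ih =>
    have hm : wordBracket ι P l - wordBracket ι P l' ∈ wordSpan k ι 1 l.length :=
      sub_mem (wordBracket_mem hP1 hP3 l) (h.length_eq ▸ wordBracket_mem hP1 hP3 l')
    have h1 := mul_mem_wordSpan (D := 2) (M := l.length + 1) (mem_wordSpan_one x) ih (by omega)
    have h2 := Submodule.smul_mem _ (2 : k)⁻¹ (ι_mul_symmetrization_sub_mem he x hm)
    rw [List.length_cons]
    convert add_mem h1 h2 using 1
    simp only [List.map_cons, List.prod_cons, wordBracket, (h.map ι).prod_eq, map_add, map_sub,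
      mul_sub, smul_sub, smul_add, mul_smul_comm]
    abel
  | swap x y l =>
    have h1 := ι_mul_symmetrization_sub_mem he ⁅y, x⁆
      (prod_mem_wordSpan (k := k) (f := ι) (d := 0) l le_rfl)
    have h2 := mul_mem_wordSpan (D := 2) (M := l.length + 2)
      (mem_wordSpan_one (k := k) (f := UniversalEnvelopingAlgebra.ι k) ⁅y, x⁆)
      (word_sub_symmetrization_mem he l) (by omega)
    have h3 := add_mem (wordSpan_mono (d' := 2) (N' := l.length + 2) (by omega) h1) h2
    rw [List.length_cons, List.length_cons]
    convert h3 using 1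
    have hC : wordBracket ι P (y :: x :: l) =
        wordBracket ι P (x :: y :: l) + (2 : k) • (ι ⁅y, x⁆ * (l.map ι).prod) := by
      simp only [wordBracket, List.map_cons, List.prod_cons, hP3, hP1, two_smul]
      rw [← lie_skew y x, map_neg]
      ring
    rw [hC, map_add, map_smul, smul_add, smul_smul, inv_mul_cancel₀ two_ne_zero, one_smul,
      mul_sub, ← ι_mul_sub_swap y x (l.map (UniversalEnvelopingAlgebra.ι k)).prod]
    simp only [List.map_cons, List.prod_cons]
    abel
  | trans h₁ _ ih₁ ih₂ =>
    rw [← h₁.length_eq] at ih₂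
    simpa using add_mem ih₁ ih₂

/-- The first order expansion of a word in terms of symmetrized products. -/
lemma word_sub_expansion_mem (he : IsSymmetrization k L S ι e)
    (hP1 : ∀ g h : L, P (ι g) (ι h) = ι ⁅g, h⁆)
    (hP2 : ∀ a b c : S, P (a * b) c = a * P b c + b * P a c)
    (hP3 : ∀ a b c : S, P a (b * c) = b * P a c + c * P a b) (l : List L) :
    (l.map (UniversalEnvelopingAlgebra.ι k)).prod - (2 : k)⁻¹ • e (wordBracket ι P l) -
      e (l.map ι).prod ∈ wordSpan k (UniversalEnvelopingAlgebra.ι k : L → _) 2 l.length := by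
  rw [symmetrization_prod he]
  have := sub_average_mem (k := k)
    (W := wordSpan k (UniversalEnvelopingAlgebra.ι k : L → _) 2 l.length)
    (fun l' => if l'.length = l.length then
      (l'.map (UniversalEnvelopingAlgebra.ι k)).prod - (2 : k)⁻¹ • e (wordBracket ι P l') else 0)
    (fun a b h => by
      simp only [h.length_eq]
      split_ifs with hb
      · rw [← hb, ← h.length_eq]
        exact corrected_word_sub_mem_of_perm he hP1 hP3 h
      · simp) l
  simpa only [List.length_ofFn, if_true, Finset.sum_sub_distrib, ← Finset.smul_sum, ← map_sum,
    sum_wordBracket_perm hP1 hP2 hP3, map_zero, smul_zero, sub_zero] using this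

lemma symmetrization_mul_sub_poisson_mem (he : IsSymmetrization k L S ι e)
    (hP1 : ∀ g h : L, P (ι g) (ι h) = ι ⁅g, h⁆)
    (hP2 : ∀ a b c : S, P (a * b) c = a * P b c + b * P a c)
    (hP3 : ∀ a b c : S, P a (b * c) = b * P a c + c * P a b) (a b : List L) :
    e (a.map ι).prod * e (b.map ι).prod - e ((a.map ι).prod * (b.map ι).prod) -
      (2 : k)⁻¹ • e (P (a.map ι).prod (b.map ι).prod) ∈
      wordSpan k (UniversalEnvelopingAlgebra.ι k : L → _) 2 (a.length + b.length) := by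
  have hu : ∀ l : List L, (l.map (UniversalEnvelopingAlgebra.ι k)).prod ∈
      wordSpan k (UniversalEnvelopingAlgebra.ι k : L → _) 0 l.length :=
    fun l => prod_mem_wordSpan l le_rfl
  have hs : ∀ l : List L, (l.map ι).prod ∈ wordSpan k ι 0 l.length :=
    fun l => prod_mem_wordSpan l le_rfl
  have hC := fun l : List L => wordBracket_mem hP1 hP3 l
  have hR := word_sub_expansion_mem he hP1 hP2 hP3
  have hab := hR (a ++ b)
  rw [wordBracket_append hP2 hP3, List.map_append, List.prod_append, List.map_append,
    List.prod_append, List.length_append] at hab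
  have h1 := mul_mem_wordSpan (D := 2) (M := a.length + b.length) (hR a)
    (symmetrization_mem he (hs b)) (by omega)
  have h2 := mul_mem_wordSpan (D := 2) (M := a.length + b.length) (hu a) (hR b) (by omega)
  have h3 := mul_mem_wordSpan (D := 2) (M := a.length + b.length)
    (word_sub_symmetrization_mem he a) (symmetrization_mem he (hC b)) (by omega)
  have h4 := symmetrization_mul_sub_mem he (hC a) (hs b)
  have h5 := symmetrization_mul_sub_mem he (hs a) (hC b)
  have h6 := Submodule.smul_mem _ (2 : k)⁻¹ (add_mem (add_mem h3 h4) h5)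
  convert sub_mem (sub_mem (sub_mem hab h1) h2) h6 using 1
  simp only [map_add, smul_add, smul_sub, mul_sub, sub_mul, smul_mul_assoc, mul_smul_comm]
  abel

end Poisson

section Components

variable {k : Type} [Field k] {L : Type} [LieRing L] [LieAlgebra k L]
  {S : Type} [CommRing S] [Algebra k S] {ι : L →ₗ[k] S}

lemma prod_mem_Sdeg (l : List L) : (l.map ι).prod ∈ Sdeg k L S ι l.length := by
  induction l with
  | nil => simpa [Sdeg] using Submodule.one_le.1 (le_refl (1 : Submodule k S))
  | cons x l ih =>
    rw [List.map_cons, List.prod_cons, Sdeg, List.length_cons, pow_succ']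
    exact Submodule.mul_mem_mul ⟨x, rfl⟩ ih

lemma wordSpan_le_iSup_Sdeg (d N : ℕ) :
    wordSpan k ι d N ≤ ⨆ n : {n : ℕ // n + d ≤ N}, Sdeg k L S ι n := by
  refine Submodule.span_le.2 ?_
  rintro _ ⟨l, hl, rfl⟩
  exact Submodule.mem_iSup_of_mem ⟨l.length, hl⟩ (prod_mem_Sdeg l)

lemma poisson_prod_mem_Sdeg {P : S →ₗ[k] S →ₗ[k] S}
    (hP1 : ∀ g h : L, P (ι g) (ι h) = ι ⁅g, h⁆)
    (hP2 : ∀ a b c : S, P (a * b) c = a * P b c + b * P a c)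
    (hP3 : ∀ a b c : S, P a (b * c) = b * P a c + c * P a b) (a b : List L) :
    P (a.map ι).prod (b.map ι).prod ∈ Sdeg k L S ι (a.length + b.length - 1) := by
  have hmul : ∀ {n m r : ℕ} {s t : S}, s ∈ Sdeg k L S ι n → t ∈ Sdeg k L S ι m → n + m = r →
      s * t ∈ Sdeg k L S ι r := by
    rintro n m _ s t hs ht rfl
    rw [Sdeg, pow_add]
    exact Submodule.mul_mem_mul hs ht
  have hι : ∀ x : L, ι x ∈ Sdeg k L S ι 1 := fun x => by simpa using prod_mem_Sdeg (ι := ι) [x]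
  have h1 : ∀ (x : L) (b : List L), P (ι x) (b.map ι).prod ∈ Sdeg k L S ι b.length := by
    intro x b
    induction b with
    | nil => simp [poisson_one_right hP3]
    | cons y b ih =>
      rw [List.map_cons, List.prod_cons, hP3, hP1]
      exact add_mem (hmul (hι y) ih (by simp; omega)) (hmul (prod_mem_Sdeg b) (hι _) (by simp))
  induction a with
  | nil => simp [poisson_one_left hP2]
  | cons x a ih =>
    rw [List.map_cons, List.prod_cons, hP2]
    refine add_mem ?_ (hmul (prod_mem_Sdeg a) (h1 x b) (by simp))
    by_cases h : a.length + b.length = 0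
    · have ha : a = [] := List.length_eq_zero_iff.1 (by omega)
      simp [ha, poisson_one_left hP2]
    · exact hmul (hι x) ih (by simp; omega)

lemma span_prod_eq_top (hS : IsSymmAlg k L S ι) :
    Submodule.span k (Set.range fun l : List L => (l.map ι).prod) = ⊤ := by
  have h := Algebra.adjoin_eq_span k (Set.range ι)
  rw [show Algebra.adjoin k (Set.range ι) = ⊤ from hS, Algebra.top_toSubmodule] at h
  rw [h]
  congr 1
  ext s
  constructor
  · rintro ⟨l, rfl⟩
    refine Submonoid.list_prod_mem _ fun s hs => ?_
    obtain ⟨x, -, rfl⟩ := List.mem_map.1 hs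
    exact Submonoid.subset_closure ⟨x, rfl⟩
  · intro hs
    induction hs using Submonoid.closure_induction with
    | mem s hs =>
      obtain ⟨x, rfl⟩ := hs
      exact ⟨[x], by simp⟩
    | one => exact ⟨[], by simp⟩
    | mul s t _ _ h1 h2 =>
      obtain ⟨a, rfl⟩ := h1
      obtain ⟨b, rfl⟩ := h2
      exact ⟨a ++ b, by simp⟩

lemma B_one_prod [CharZero k] {e : S →ₗ[k] UniversalEnvelopingAlgebra k L}
    (he : IsSymmetrization k L S ι e) (hbij : Function.Bijective e)
    {B : ℕ → S →ₗ[k] S →ₗ[k] S} (hB : IsPBWComponents k L S ι e B)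
    {P : S →ₗ[k] S →ₗ[k] S}
    (hP1 : ∀ g h : L, P (ι g) (ι h) = ι ⁅g, h⁆)
    (hP2 : ∀ a b c : S, P (a * b) c = a * P b c + b * P a c)
    (hP3 : ∀ a b c : S, P a (b * c) = b * P a c + c * P a b) (a b : List L) :
    B 1 (a.map ι).prod (b.map ι).prod = (2 : k)⁻¹ • P (a.map ι).prod (b.map ι).prod := by
  obtain ⟨hdeg, hvan, hsum⟩ := hB
  have ha := prod_mem_Sdeg (ι := ι) a
  have hb := prod_mem_Sdeg (ι := ι) b
  have hPab := poisson_prod_mem_Sdeg hP1 hP2 hP3 a b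
  have hmain := wordSpan_le_map he _ _ (symmetrization_mul_sub_poisson_mem he hP1 hP2 hP3 a b)
  have habm : (a.map ι).prod * (b.map ι).prod ∈ Sdeg k L S ι (a.length + b.length) := by
    simpa using prod_mem_Sdeg (ι := ι) (a ++ b)
  rw [← hsum _ _ _ ha _ hb] at hmain
  by_cases h0 : a.length + b.length = 0
  · rw [hvan 1 _ _ (by omega) _ ha _ hb]
    have ha : a = [] := List.length_eq_zero_iff.1 (by omega)
    simp [ha, poisson_one_left hP2]
  have hdeg' := fun p => hdeg p _ _ _ ha _ hb
  generalize (a.map ι).prod = x at *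
  generalize (b.map ι).prod = y at *
  obtain ⟨N, hN⟩ : ∃ N, a.length + b.length = N + 1 := ⟨a.length + b.length - 1, by omega⟩
  rw [hN] at hmain hdeg' hPab habm
  obtain ⟨r, hr, hre⟩ := hmain
  rw [← map_smul, ← map_sub, ← map_sub] at hre
  have hr' := hbij.1 hre
  rw [Finset.sum_range_succ', Finset.sum_range_succ'] at hr'
  have hD : B 1 x y - (2 : k)⁻¹ • P x y ∈ Sdeg k L S ι N :=
    sub_mem (hdeg' 1) (Submodule.smul_mem _ _ hPab)
  have hlow : wordSpan k ι 2 (N + 1) ≤ ⨆ (n) (_ : n ≠ N), Sdeg k L S ι n :=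
    (wordSpan_le_iSup_Sdeg 2 (N + 1)).trans
      (iSup_le fun n => le_iSup₂_of_le n.1 (by have := n.2; omega) le_rfl)
  have hD' : B 1 x y - (2 : k)⁻¹ • P x y ∈ ⨆ (n) (_ : n ≠ N), Sdeg k L S ι n := by
    have h1 : B 0 x y - x * y ∈ ⨆ (n) (_ : n ≠ N), Sdeg k L S ι n :=
      (le_iSup₂_of_le (f := fun n (_ : n ≠ N) => Sdeg k L S ι n) (N + 1) (by omega) le_rfl)
        (sub_mem (hdeg' 0) habm)
    have h2 : ∑ p ∈ Finset.range N, B (p + 1 + 1) x y ∈ ⨆ (n) (_ : n ≠ N), Sdeg k L S ι n :=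
      Submodule.sum_mem _ fun p hp =>
        (le_iSup₂_of_le (f := fun n (_ : n ≠ N) => Sdeg k L S ι n) (N + 1 - (p + 1 + 1))
          (by have := Finset.mem_range.1 hp; omega) le_rfl) (hdeg' (p + 1 + 1))
    convert sub_mem (sub_mem (hlow hr) h1) h2 using 1
    rw [hr']
    simp only [zero_add]
    abel
  exact sub_eq_zero.1 (Submodule.disjoint_def.1 (iSupIndep_Sdeg he hbij N) _ hD hD')

end Components

lemma leibniz_finset_prod {k S κ : Type} [Field k] [CommRing S] [Algebra k S] [DecidableEq κ]
    (D : S →ₗ[k] S)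
    (hD : ∀ b c : S, D (b * c) = b * D c + c * D b) (f : κ → S) (s : Finset κ) :
    D (∏ i ∈ s, f i) = ∑ i ∈ s, (∏ i' ∈ s.erase i, f i') * D (f i) := by
  induction s using Finset.induction_on with
  | empty => simpa using hD 1 1
  | insert a s ha ih =>
    rw [Finset.prod_insert ha, hD, ih, Finset.sum_insert ha, Finset.erase_insert ha, add_comm,
      Finset.mul_sum]
    congr 1
    refine Finset.sum_congr rfl fun i hi => ?_
    have hne : a ≠ i := fun h => ha (h ▸ hi)
    rw [Finset.erase_insert_of_ne hne, Finset.prod_insert (fun h => ha (Finset.mem_of_mem_erase h)),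
      mul_assoc]

/-- Formula (4), second part: `B_1(x,y) = (1/2){x,y}`, where `{,}` is the Poisson
bracket on `S𝔤` induced by the Lie bracket of `𝔤` (the unique biderivation `P`
extending the Lie bracket).  Explicitly, for `x_1,…,x_n, y_1,…,y_m ∈ 𝔤`,
`B_1(x_1⋯x_n, y_1⋯y_m) = (1/2) ∑_{i,j} x_1⋯x̂_i⋯x_n ⋅ y_1⋯ŷ_j⋯y_m ⋅ [x_i,y_j]`. -/
theorem B_one_eq_half_poisson (k : Type) [Field k] [CharZero k]
    (L : Type) [LieRing L] [LieAlgebra k L]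
    (S : Type) [CommRing S] [Algebra k S] (ι : L →ₗ[k] S)
    (hS : IsSymmAlg k L S ι)
    (e : S →ₗ[k] UniversalEnvelopingAlgebra k L)
    (he : IsSymmetrization k L S ι e) (hbij : Function.Bijective e)
    (B : ℕ → S →ₗ[k] S →ₗ[k] S) (hB : IsPBWComponents k L S ι e B)
    -- `P` is the Poisson bracket of `S𝔤`: the unique biderivation extending the
    -- Lie bracket of `𝔤`.
    (P : S →ₗ[k] S →ₗ[k] S)
    (hP1 : ∀ g h : L, P (ι g) (ι h) = ι ⁅g, h⁆)
    (hP2 : ∀ a b c : S, P (a * b) c = a * P b c + b * P a c)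
    (hP3 : ∀ a b c : S, P a (b * c) = b * P a c + c * P a b) :
    (∀ x y : S, B 1 x y = (2 : k)⁻¹ • P x y) ∧
    (∀ (n m : ℕ) (x : Fin n → L) (y : Fin m → L),
      B 1 (∏ i, ι (x i)) (∏ j, ι (y j)) =
        (2 : k)⁻¹ • ∑ i : Fin n, ∑ j : Fin m,
          (∏ i' ∈ Finset.univ.erase i, ι (x i')) *
          (∏ j' ∈ Finset.univ.erase j, ι (y j')) * ι ⁅x i, y j⁆) := by
  have key : ∀ x y : S, B 1 x y = (2 : k)⁻¹ • P x y := by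
    have h : B 1 = (2 : k)⁻¹ • P := by
      refine LinearMap.ext_on_range (span_prod_eq_top hS) fun a => ?_
      refine LinearMap.ext_on_range (span_prod_eq_top hS) fun b => ?_
      exact B_one_prod he hbij hB hP1 hP2 hP3 a b
    intro x y
    rw [h]
    rfl
  refine ⟨key, fun n m x y => ?_⟩
  rw [key, leibniz_finset_prod (P _) (hP3 _) (fun j => ι (y j)), Finset.sum_comm]
  congr 1
  refine Finset.sum_congr rfl fun j _ => ?_
  have h := leibniz_finset_prod (P.flip (ι (y j)))
    (fun b c => hP2 b c _) (fun i => ι (x i)) Finset.univ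
  simp only [LinearMap.flip_apply, hP1] at h ⊢
  rw [h, Finset.mul_sum]
  exact Finset.sum_congr rfl fun i _ => by ring

end
end
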